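/- arXiv:2509.03034 — 2 statements merged into one kernel-verified Lean document; each statement's English description precedes it below -/
import Mathlib

section
/- Let q be a power of an odd prime, f ∈ 𝔽_q[X] square-free of degree 3, and let D consist of n pairwise distinct affine points P_i = (α_i, β_i) of y² = f(x) with β_i ≠ 0 for all i. Let k be odd with 4 ≤ k ≤ (n−4)/2 or (n+4)/2 ≤ k ≤ n−4, and let 0 ≤ ℓ ≤ (k−3)/2 and η ∈ 𝔽_q^*. Then the twisted elliptic curve code C(D, kO, ℓ, η) is not monomially equivalent to any generalized Reed–Solomon code GRS_k(a, u) of length n over 𝔽_q. -/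
open Polynomial

theorem isSquare_C_of_isAlgClosed {K : Type*} [Field K] [IsAlgClosed K] (c : K) :
    IsSquare (C c : K[X]) := by
  obtain ⟨e, he⟩ := IsAlgClosed.exists_pow_nat_eq c (n := 2) (by norm_num)
  exact ⟨C e, by rw [← C_mul, ← sq, he]⟩

theorem isSquare_left_of_isCoprime {K : Type*} [Field K] [IsAlgClosed K] {P Q : K[X]}
    (h : IsCoprime P Q) (hs : IsSquare (P * Q)) : IsSquare P := by
  obtain ⟨W, hW⟩ := hs
  obtain ⟨d, u, hu⟩ := exists_associated_pow_of_mul_eq_pow' h (k := 2) (c := W) (by rw [hW, sq])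
  obtain ⟨c, -, hc⟩ := Polynomial.isUnit_iff.mp u.isUnit
  rw [← hu, ← hc]
  exact (IsSquare.sq d).mul (isSquare_C_of_isAlgClosed c)

theorem isSquare_right_of_isCoprime {K : Type*} [Field K] [IsAlgClosed K] {P Q : K[X]}
    (h : IsCoprime P Q) (hs : IsSquare (P * Q)) : IsSquare Q :=
  isSquare_left_of_isCoprime h.symm (by rwa [mul_comm])

theorem isSquare_of_C_mul {K : Type*} [Field K] [IsAlgClosed K] {c : K} (hc : c ≠ 0) {P : K[X]}
    (hs : IsSquare (C c * P)) : IsSquare P := by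
  have := (isSquare_C_of_isAlgClosed c⁻¹).mul hs
  rwa [← mul_assoc, ← C_mul, inv_mul_cancel₀ hc, C_1, one_mul] at this

/-- Two coprime polynomials with four distinct ratios of linear combinations that are squares
are constant. -/
theorem natDegree_eq_zero_of_four_squares {K : Type*} [Field K] [IsAlgClosed K]
    (h2 : (2 : K) ≠ 0) (N : ℕ) : ∀ (P Q : K[X]) (c : K), P.natDegree ≤ N → Q.natDegree ≤ N →
      IsCoprime P Q → c ≠ 0 → c ≠ 1 → IsSquare P → IsSquare Q → IsSquare (P - Q) →
      IsSquare (P - C c * Q) → P.natDegree = 0 ∧ Q.natDegree = 0 := by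
  induction N using Nat.strong_induction_on with
  | _ N ih =>
  intro P Q c hP hQ hPQ hc0 hc1 ⟨U, hU⟩ ⟨V, hV⟩ h1 h3
  rcases Nat.eq_zero_or_pos N with hN | hN
  · omega
  obtain ⟨m, hm⟩ := IsAlgClosed.exists_pow_nat_eq c (n := 2) (by norm_num)
  have hUd : P.natDegree = U.natDegree + U.natDegree := by
    rw [hU, ← sq, natDegree_pow]; ring
  have hVd : Q.natDegree = V.natDegree + V.natDegree := by
    rw [hV, ← sq, natDegree_pow]; ring
  have hm0 : m ≠ 0 := by rintro rfl; simp at hm; exact hc0 hm.symm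
  have hm1 : 1 - m ≠ 0 := fun h => hc1 (by rw [← hm]; linear_combination (-1 - m) * h)
  have hm2 : 1 + m ≠ 0 := fun h => hc1 (by rw [← hm]; linear_combination (m - 1) * h)
  have hUV : IsCoprime U V := by
    rw [hU, hV] at hPQ
    exact (IsCoprime.of_mul_left_left hPQ).of_mul_right_left
  have cop : ∀ x y : K, x - y ≠ 0 → IsCoprime (U + C x * V) (U + C y * V) := by
    intro x y hxy
    obtain ⟨p, q, hpq⟩ := hUV
    have e : C (x - y)⁻¹ * (C x - C y) = (1 : K[X]) := by
      rw [← C_sub, ← C_mul, inv_mul_cancel₀ hxy, C_1]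
    refine ⟨C (x - y)⁻¹ * (q - C y * p), C (x - y)⁻¹ * (C x * p - q), ?_⟩
    linear_combination (p * U + q * V) * e + hpq
  have s1 : IsSquare ((U + C (-1) * V) * (U + C 1 * V)) := by
    convert h1 using 1
    rw [hU, hV, C_neg, C_1]; ring
  have s2 : IsSquare ((U + C (-m) * V) * (U + C m * V)) := by
    convert h3 using 1
    rw [hU, hV, ← hm, C_neg, C_pow]; ring
  have c1 := cop (-1) 1 (by intro h; apply h2; linear_combination -h)
  have c2 := cop (-m) m (by
    intro h; apply mul_ne_zero h2 hm0; linear_combination -h)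
  have hh : C (2 : K)⁻¹ * 2 = (1 : K[X]) := by
    rw [show (2 : K[X]) = C 2 from (map_ofNat C 2).symm, ← C_mul, inv_mul_cancel₀ h2, C_1]
  have a1 : (1 + m) / 2 ≠ 0 := div_ne_zero hm2 h2
  have a2 : -(1 - m) / 2 ≠ 0 := div_ne_zero (neg_ne_zero.mpr hm1) h2
  have key := ih (N / 2) (by omega) (C ((1 + m) / 2) * (U + C (-1) * V))
    (C (-(1 - m) / 2) * (U + C 1 * V)) (((1 + m) / (1 - m)) ^ 2) ?_ ?_ ?_ ?_ ?_ ?_ ?_ ?_ ?_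
  · rw [natDegree_C_mul a1, natDegree_C_mul a2] at key
    have hU0 : (C 2 * U).natDegree = 0 := by
      have : C 2 * U = (U + C (-1) * V) + (U + C 1 * V) := by
        rw [C_neg, C_1, map_ofNat]; ring
      rw [this]
      exact Nat.le_zero.mp ((natDegree_add_le _ _).trans (max_le key.1.le key.2.le))
    have hV0 : (C 2 * V).natDegree = 0 := by
      have : C 2 * V = (U + C 1 * V) - (U + C (-1) * V) := by
        rw [C_neg, C_1, map_ofNat]; ring
      rw [this]
      exact Nat.le_zero.mp ((natDegree_sub_le _ _).trans (max_le key.2.le key.1.le))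
    rw [natDegree_C_mul h2] at hU0 hV0
    omega
  · rw [natDegree_C_mul a1]
    refine (natDegree_add_le _ _).trans (max_le (by omega) ((natDegree_C_mul_le _ _).trans (by omega)))
  · rw [natDegree_C_mul a2]
    refine (natDegree_add_le _ _).trans (max_le (by omega) ((natDegree_C_mul_le _ _).trans (by omega)))
  · exact (isCoprime_mul_unit_left_left (isUnit_C.mpr a1.isUnit) _ _).mpr
      ((isCoprime_mul_unit_left_right (isUnit_C.mpr a2.isUnit) _ _).mpr c1)
  · exact pow_ne_zero 2 (div_ne_zero hm2 hm1)
  · intro h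
    rw [div_pow, div_eq_one_iff_eq (pow_ne_zero 2 hm1)] at h
    apply mul_ne_zero (mul_ne_zero h2 h2) hm0
    linear_combination h
  · exact (isSquare_C_of_isAlgClosed _).mul (isSquare_left_of_isCoprime c1 s1)
  · exact (isSquare_C_of_isAlgClosed _).mul (isSquare_right_of_isCoprime c1 s1)
  · convert isSquare_left_of_isCoprime c2 s2 using 1
    simp only [div_eq_mul_inv, C_mul, C_neg, C_add, C_sub, C_1]
    linear_combination (U - C m * V) * hh
  · refine isSquare_of_C_mul (c := (1 - m) / (1 + m)) (div_ne_zero hm1 hm2) ?_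
    convert isSquare_right_of_isCoprime c2 s2 using 1
    have e1 : C ((1 - m) / (1 + m)) * C ((1 + m) / 2) = C ((1 - m) * 2⁻¹) := by
      rw [← C_mul]; congr 1; field_simp
    have e2 : C ((1 - m) / (1 + m)) * (C (((1 + m) / (1 - m)) ^ 2) * C (-(1 - m) / 2))
        = C (-(1 + m) * 2⁻¹) := by
      rw [← C_mul, ← C_mul]; congr 1; field_simp
    simp only [C_mul, C_neg, C_add, C_sub, C_1] at e1 e2 ⊢
    linear_combination (U - V) * e1 - (U + V) * e2 + (U + C m * V) * hh

theorem natDegree_eq_zero_of_cubic_eq_sq {K : Type*} [Field K] [IsAlgClosed K] (h2 : (2 : K) ≠ 0)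
    {P Q W : K[X]} (hPQ : IsCoprime P Q) {l e₁ e₂ e₃ : K} (hl : l ≠ 0) (h12 : e₁ ≠ e₂)
    (h13 : e₁ ≠ e₃) (h23 : e₂ ≠ e₃)
    (h : Q * (C l * ((P - C e₁ * Q) * (P - C e₂ * Q) * (P - C e₃ * Q))) = W ^ 2) :
    P.natDegree = 0 ∧ Q.natDegree = 0 := by
  have c0 : ∀ e, IsCoprime Q (P - C e * Q) := fun e => by
    rw [show P - C e * Q = P + Q * -C e by ring]
    exact IsCoprime.add_mul_left_right_iff.mpr hPQ.symm
  have c1 : ∀ x y : K, x ≠ y → IsCoprime (P - C x * Q) (P - C y * Q) := by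
    intro x y hxy
    obtain ⟨p, q, hpq⟩ := hPQ
    have e : C (y - x)⁻¹ * (C y - C x) = (1 : K[X]) := by
      rw [← C_sub, ← C_mul, inv_mul_cancel₀ (sub_ne_zero.mpr hxy.symm), C_1]
    refine ⟨C (y - x)⁻¹ * (q + C y * p), C (y - x)⁻¹ * (-C x * p - q), ?_⟩
    linear_combination (p * P + q * Q) * e + hpq
  have hs : IsSquare (Q * ((P - C e₁ * Q) * ((P - C e₂ * Q) * (P - C e₃ * Q)))) :=
    isSquare_of_C_mul hl ⟨W, by rw [← sq, ← h]; ring⟩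
  have k0 := (c0 e₁).mul_right ((c0 e₂).mul_right (c0 e₃))
  have k1 := (c1 _ _ h12).mul_right (c1 _ _ h13)
  have k2 := c1 _ _ h23
  have q0 := isSquare_left_of_isCoprime k0 hs
  have hs := isSquare_right_of_isCoprime k0 hs
  have q1 := isSquare_left_of_isCoprime k1 hs
  have hs := isSquare_right_of_isCoprime k1 hs
  have q2 := isSquare_left_of_isCoprime k2 hs
  have q3 := isSquare_right_of_isCoprime k2 hs
  have d : e₂ - e₁ ≠ 0 := sub_ne_zero.mpr h12.symm
  have key := natDegree_eq_zero_of_four_squares h2 _ (P - C e₁ * Q) (C (e₂ - e₁) * Q)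
    ((e₃ - e₁) / (e₂ - e₁)) (le_max_left _ _) (le_max_right _ _)
    ((isCoprime_mul_unit_left_right (isUnit_C.mpr d.isUnit) _ _).mpr (c0 e₁).symm)
    (div_ne_zero (sub_ne_zero.mpr h13.symm) d)
    (fun h => h23 (by rw [div_eq_one_iff_eq d] at h; linear_combination -h))
    q1 ((isSquare_C_of_isAlgClosed _).mul q0)
    (by convert q2 using 1; rw [C_sub]; ring)
    (by
      convert q3 using 1
      rw [← mul_assoc, ← C_mul, div_mul_cancel₀ _ d, C_sub]; ring)
  rw [natDegree_C_mul d] at key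
  refine ⟨?_, key.2⟩
  have : P = (P - C e₁ * Q) + C e₁ * Q := by ring
  rw [this]
  refine Nat.le_zero.mp ((natDegree_add_le _ _).trans (max_le key.1.le
    ((natDegree_C_mul_le _ _).trans key.2.le)))

/-- The degree `n` binary form attached to `p`, evaluated at a pair of polynomials. -/
noncomputable def binaryForm {R : Type*} [CommRing R] (n : ℕ) (p c b : R[X]) : R[X] :=
  MvPolynomial.aeval ![c, b] (p.homogenize n)

theorem binaryForm_eq_sum {R : Type*} [CommRing R] (n : ℕ) (p c b : R[X]) :
    binaryForm n p c b =
      ∑ kl ∈ Finset.HasAntidiagonal.antidiagonal n, C (p.coeff kl.1) * (c ^ kl.1 * b ^ kl.2) := by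
  rw [binaryForm, homogenize, map_sum]
  refine Finset.sum_congr rfl fun kl _ => ?_
  rw [MvPolynomial.aeval_monomial, Finsupp.prod_fintype _ _ (by simp)]
  simp [Fin.prod_univ_two, algebraMap_eq]

theorem binaryForm_mul {R : Type*} [CommRing R] {m n : ℕ} {p q : R[X]} (hp : p.natDegree ≤ m)
    (hq : q.natDegree ≤ n) (c b : R[X]) :
    binaryForm (m + n) (p * q) c b = binaryForm m p c b * binaryForm n q c b := by
  simp [binaryForm, homogenize_mul p q hp hq]

theorem binaryForm_sub {R : Type*} [CommRing R] (n : ℕ) (p q c b : R[X]) :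
    binaryForm n (p - q) c b = binaryForm n p c b - binaryForm n q c b := by
  simp [binaryForm]

theorem binaryForm_C_mul {R : Type*} [CommRing R] (n : ℕ) (r : R) (p c b : R[X]) :
    binaryForm n (C r * p) c b = C r * binaryForm n p c b := by
  simp [binaryForm, algebraMap_eq]

theorem binaryForm_X_sub_C {R : Type*} [CommRing R] (r : R) (c b : R[X]) :
    binaryForm 1 (X - C r) c b = c - C r * b := by
  simp [binaryForm, algebraMap_eq]

theorem binaryForm_succ {R : Type*} [CommRing R] {n : ℕ} {p : R[X]} (hp : p.natDegree ≤ n)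
    (c b : R[X]) : binaryForm (n + 1) p c b = b * binaryForm n p c b := by
  have h := binaryForm_mul hp (natDegree_one.trans_le zero_le_one) c b
  rw [mul_one] at h
  rw [h, mul_comm]
  simp [binaryForm]

theorem binaryForm_map {R S : Type*} [CommRing R] [CommRing S] (φ : R →+* S) (n : ℕ)
    (p c b : R[X]) :
    (binaryForm n p c b).map φ = binaryForm n (p.map φ) (c.map φ) (b.map φ) := by
  simp [binaryForm_eq_sum, Polynomial.map_sum]

theorem binaryForm_mul_mul {R : Type*} [CommRing R] (n : ℕ) (p g c b : R[X]) :
    binaryForm n p (g * c) (g * b) = g ^ n * binaryForm n p c b := by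
  rw [binaryForm_eq_sum, binaryForm_eq_sum, Finset.mul_sum]
  refine Finset.sum_congr rfl fun kl h => ?_
  rw [← Finset.HasAntidiagonal.mem_antidiagonal.mp h]
  ring

theorem eval_binaryForm {R : Type*} [CommRing R] {n : ℕ} {p : R[X]} (hp : p.natDegree ≤ n)
    {c b : R[X]} {t x : R} (h : c.eval t = x * b.eval t) :
    (binaryForm n p c b).eval t = p.eval x * b.eval t ^ n := by
  rw [binaryForm_eq_sum, eval_finsetSum, eval_eq_sum_range' (Nat.lt_succ_of_le hp),
    Finset.sum_mul, Finset.Nat.sum_antidiagonal_eq_sum_range_succ_mk]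
  refine Finset.sum_congr rfl fun i hi => ?_
  obtain ⟨j, rfl⟩ := Nat.exists_eq_add_of_le (Nat.lt_succ_iff.mp (Finset.mem_range.mp hi))
  simp [h]
  ring

theorem natDegree_binaryForm_le {R : Type*} [CommRing R] (n : ℕ) (p : R[X]) {c b : R[X]} {d : ℕ}
    (hc : c.natDegree ≤ d) (hb : b.natDegree ≤ d) : (binaryForm n p c b).natDegree ≤ n * d := by
  rw [binaryForm_eq_sum]
  refine natDegree_sum_le_of_forall_le _ _ fun kl h => (natDegree_C_mul_le _ _).trans ?_
  rw [← Finset.HasAntidiagonal.mem_antidiagonal.mp h, add_mul]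
  exact natDegree_mul_le.trans (add_le_add (natDegree_pow_le_of_le _ hc)
    (natDegree_pow_le_of_le _ hb))

/-- A curve `y ^ 2 = f x` with `f` a square-free cubic has no nonconstant rational
parametrization. -/
theorem exists_map_eq_C_mul_map_of_sq_eq {F : Type*} [Field F] [PerfectField F]
    (K : Type*) [Field K] [IsAlgClosed K] [Algebra F K] (h2 : (2 : F) ≠ 0)
    {f : F[X]} (hsf : Squarefree f) (hdeg : f.natDegree = 3) {b c Y Z : F[X]} (hb : b ≠ 0)
    (hZ : Z ≠ 0) (h : Y ^ 2 = Z ^ 2 * (b * binaryForm 3 f c b)) :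
    ∃ e : K, c.map (algebraMap F K) =
      C e * b.map (algebraMap F K) := by
  classical
  set φ := algebraMap F K
  have hf0 : f ≠ 0 := hsf.ne_zero
  have hsep : (f.map φ).Separable := (PerfectField.separable_iff_squarefree.mpr hsf).map
  have hspl : (f.map φ).Splits := IsAlgClosed.splits _
  have hcard : (f.map φ).roots.card = 3 := by
    rw [← hspl.natDegree_eq_card_roots, natDegree_map, hdeg]
  obtain ⟨e₁, e₂, e₃, hr⟩ := Multiset.card_eq_three.mp hcard
  have hnd := nodup_roots hsep
  have hprod := hspl.eq_prod_roots
  rw [hr] at hnd hprod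
  simp at hnd
  set l := (f.map φ).leadingCoeff
  have hl : l ≠ 0 := leadingCoeff_ne_zero.mpr (map_ne_zero hf0)
  have hform : ∀ P Q : K[X], binaryForm 3 (f.map φ) P Q =
      C l * ((P - C e₁ * Q) * (P - C e₂ * Q) * (P - C e₃ * Q)) := by
    intro P Q
    rw [hprod, binaryForm_C_mul]
    have d : ∀ e : K, (X - C e).natDegree ≤ 1 := fun e => (natDegree_X_sub_C e).le
    have d2 : ((X - C e₁) * (X - C e₂)).natDegree ≤ 1 + 1 :=
      natDegree_mul_le.trans (add_le_add (d _) (d _))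
    have e : (Multiset.map (fun a => X - C a) {e₁, e₂, e₃}).prod =
        (X - C e₁) * (X - C e₂) * (X - C e₃) := by simp [mul_assoc]
    rw [e, show 3 = 1 + 1 + 1 from rfl, binaryForm_mul d2 (d _), binaryForm_mul (d _) (d _)]
    simp only [binaryForm_X_sub_C]
  have hb' : b.map φ ≠ 0 := map_ne_zero hb
  set g := EuclideanDomain.gcd (c.map φ) (b.map φ)
  obtain ⟨P, hP⟩ : g ∣ c.map φ := EuclideanDomain.gcd_dvd_left _ _
  obtain ⟨Q, hQ⟩ : g ∣ b.map φ := EuclideanDomain.gcd_dvd_right _ _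
  have hg : g ≠ 0 := fun h0 => hb' (by rw [hQ, h0, zero_mul])
  have hPQ : IsCoprime P Q := by
    have hgcd : g = _ := EuclideanDomain.gcd_eq_gcd_ab (c.map φ) (b.map φ)
    refine ⟨EuclideanDomain.gcdA (c.map φ) (b.map φ), EuclideanDomain.gcdB (c.map φ) (b.map φ),
      mul_left_cancel₀ hg ?_⟩
    linear_combination -hgcd - EuclideanDomain.gcdA (c.map φ) (b.map φ) * hP
      - EuclideanDomain.gcdB (c.map φ) (b.map φ) * hQ
  have hK : (Y.map φ) ^ 2 = (Z.map φ * g ^ 2) ^ 2 * (Q * binaryForm 3 (f.map φ) P Q) := by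
    have := congrArg (Polynomial.map φ) h
    rw [Polynomial.map_pow, Polynomial.map_mul, Polynomial.map_mul, Polynomial.map_pow,
      binaryForm_map, hP, hQ, binaryForm_mul_mul] at this
    rw [this]; ring
  obtain ⟨W, hW⟩ := (IsIntegrallyClosed.pow_dvd_pow_iff two_ne_zero).mp (Dvd.intro _ hK.symm)
  have hZg : Z.map φ * g ^ 2 ≠ 0 := mul_ne_zero (map_ne_zero hZ) (pow_ne_zero 2 hg)
  have hW2 : Q * binaryForm 3 (f.map φ) P Q = W ^ 2 := by
    apply mul_left_cancel₀ (pow_ne_zero 2 hZg)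
    rw [← hK, hW]; ring
  rw [hform] at hW2
  have h2K : (2 : K) ≠ 0 := by
    rw [← map_ofNat φ 2]; exact (map_ne_zero_iff φ φ.injective).mpr h2
  obtain ⟨d1, d2⟩ := natDegree_eq_zero_of_cubic_eq_sq h2K hPQ hl hnd.1.1 hnd.1.2 hnd.2 hW2
  rw [eq_C_of_natDegree_eq_zero d1] at hP
  rw [eq_C_of_natDegree_eq_zero d2] at hQ
  have hq : Q.coeff 0 ≠ 0 := fun h0 => hb' (by rw [hQ, h0, C_0, mul_zero])
  refine ⟨P.coeff 0 / Q.coeff 0, ?_⟩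
  rw [hP, hQ, mul_left_comm, ← C_mul, div_mul_cancel₀ _ hq]


theorem card_filter_le_two {F ι : Type*} [Field F] [Fintype ι] [DecidableEq F]
    {f : F[X]} {α β : ι → F} (hdist : Function.Injective fun i => (α i, β i))
    (hcurve : ∀ i, β i ^ 2 = f.eval (α i)) {s : Finset ι} (hs : ∀ i ∈ s, ∀ j ∈ s, α i = α j) :
    s.card ≤ 2 := by
  rcases s.eq_empty_or_nonempty with rfl | ⟨i, hi⟩
  · simp
  rw [← Finset.card_image_of_injOn (s := s) (f := β) fun x hx y hy h =>
    hdist (Prod.ext (hs x hx y hy) h)]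
  refine (Finset.card_le_card (t := {β i, -β i}) fun y hy => ?_).trans Finset.card_le_two
  obtain ⟨j, hj, rfl⟩ := Finset.mem_image.mp hy
  have : β j ^ 2 = β i ^ 2 := by rw [hcurve, hcurve, hs j hj i hi]
  simpa using sq_eq_sq_iff_eq_or_eq_neg.mp this

theorem card_filter_eval_eq_zero_le {F ι : Type*} [Field F] [Fintype ι] [DecidableEq F]
    {a : ι → F} (ha : Function.Injective a) {b : F[X]} (hb : b ≠ 0) :
    (Finset.univ.filter fun i => b.eval (a i) = 0).card ≤ b.natDegree := by
  refine le_trans ?_ (card_roots' b)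
  rw [← Finset.card_image_of_injective _ ha]
  refine le_trans (Finset.card_le_card fun y hy => ?_) (Multiset.toFinset_card_le _)
  obtain ⟨j, hj, rfl⟩ := Finset.mem_image.mp hy
  simpa [hb] using hj

theorem eq_zero_of_natDegree_lt_card {F ι : Type*} [Field F] [Fintype ι]
    {a : ι → F} (ha : Function.Injective a) {p : F[X]} {d : ℕ} (hp : p.natDegree ≤ d)
    (hd : d < Fintype.card ι) (h : ∀ i, p.eval (a i) = 0) : p = 0 :=
  eq_zero_of_natDegree_lt_card_of_eval_eq_zero p ha h (hp.trans_lt hd)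

/-- Points of the curve `y ^ 2 = f x`, more than `d + 2` in number, do not lie on a rational
parametrization of that curve whose denominator has degree at most `d`. -/
theorem false_of_rational_parametrization {F ι : Type*} [Field F] [PerfectField F] [Fintype ι]
    (h2 : (2 : F) ≠ 0) {f : F[X]} (hsf : Squarefree f) (hdeg : f.natDegree = 3) {α β a : ι → F}
    (hdist : Function.Injective fun i => (α i, β i)) (hcurve : ∀ i, β i ^ 2 = f.eval (α i))
    (ha : Function.Injective a) {b c Y Z : F[X]} {d : ℕ} (hb : b ≠ 0) (hbd : b.natDegree ≤ d)
    (hd : d + 2 < Fintype.card ι) (hc : ∀ i, c.eval (a i) = α i * b.eval (a i))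
    (hZ : Z ≠ 0) (h : Y ^ 2 = Z ^ 2 * (b * binaryForm 3 f c b)) : False := by
  classical
  obtain ⟨e, he⟩ := exists_map_eq_C_mul_map_of_sq_eq (AlgebraicClosure F) h2 hsf hdeg hb hZ h
  have hα : ∀ i, b.eval (a i) ≠ 0 → algebraMap F (AlgebraicClosure F) (α i) = e := by
    intro i hi
    have := congrArg (eval (algebraMap F _ (a i))) he
    rw [eval_mul, eval_C, eval_map_algebraMap, eval_map_algebraMap, aeval_algebraMap_apply,
      aeval_algebraMap_apply, coe_aeval_eq_eval, hc, map_mul] at this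
    exact mul_right_cancel₀ (by simpa using hi) this
  have h1 := card_filter_eval_eq_zero_le ha hb
  have h3 : (Finset.univ.filter fun i => ¬ b.eval (a i) = 0).card ≤ 2 :=
    card_filter_le_two hdist hcurve fun i hi j hj => (algebraMap F (AlgebraicClosure F)).injective
      ((hα i (Finset.mem_filter.mp hi).2).trans (hα j (Finset.mem_filter.mp hj).2).symm)
  have h4 := Finset.card_filter_add_card_filter_not (s := (Finset.univ : Finset ι))
    (fun i => b.eval (a i) = 0)
  rw [Finset.card_univ] at h4
  omega

theorem binaryForm_three {R : Type*} [CommRing R] (p c b : R[X]) :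
    binaryForm 3 p c b = C (p.coeff 0) * b ^ 3 + C (p.coeff 1) * (c * b ^ 2) +
      C (p.coeff 2) * (c ^ 2 * b) + C (p.coeff 3) * c ^ 3 := by
  rw [binaryForm_eq_sum, Finset.Nat.sum_antidiagonal_eq_sum_range_succ_mk]
  simp [Finset.sum_range_succ]

theorem eval_cubic {R : Type*} [CommRing R] {p : R[X]} (hp : p.natDegree = 3) (x : R) :
    p.eval x = p.coeff 0 + p.coeff 1 * x + p.coeff 2 * x ^ 2 + p.coeff 3 * x ^ 3 := by
  rw [eval_eq_sum_range, hp]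
  simp [Finset.sum_range_succ]

theorem false_of_y_mem_GRS {F ι : Type*} [Field F] [PerfectField F] [Fintype ι]
    (h2 : (2 : F) ≠ 0) {f : F[X]} (hsf : Squarefree f) (hdeg : f.natDegree = 3)
    {α β a v : ι → F} (hdist : Function.Injective fun i => (α i, β i))
    (hcurve : ∀ i, β i ^ 2 = f.eval (α i))
    (ha : Function.Injective a) (hcard : 14 ≤ Fintype.card ι) {p₀ p₁ r : F[X]}
    (d₀ : p₀.natDegree ≤ 4) (d₁ : p₁.natDegree ≤ 4) (dr : r.natDegree ≤ 4)
    (h₀ : ∀ i, 1 = v i * p₀.eval (a i)) (h₁ : ∀ i, α i = v i * p₁.eval (a i))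
    (hr : ∀ i, β i = v i * r.eval (a i)) : False := by
  have hp0 : p₀ ≠ 0 := by
    rintro rfl
    have : Nonempty ι := Fintype.card_pos_iff.mp (by omega)
    simpa using h₀ (Classical.arbitrary ι)
  have hc : ∀ i, p₁.eval (a i) = α i * p₀.eval (a i) := fun i => by
    linear_combination p₁.eval (a i) * h₀ i - p₀.eval (a i) * h₁ i
  have key : r ^ 2 * p₀ - binaryForm 3 f p₁ p₀ = 0 := by
    refine eq_zero_of_natDegree_lt_card ha (d := 12) ?_ (by omega) fun i => ?_
    · refine (natDegree_sub_le _ _).trans (max_le ?_ (natDegree_binaryForm_le 3 f d₁ d₀))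
      exact natDegree_mul_le.trans (by have := natDegree_pow_le_of_le 2 dr; omega)
    · rw [eval_sub, eval_binaryForm hdeg.le (hc i), ← hcurve]
      have hri : r.eval (a i) = β i * p₀.eval (a i) := by
        linear_combination r.eval (a i) * h₀ i - p₀.eval (a i) * hr i
      simp [hri]
      ring
  refine false_of_rational_parametrization h2 hsf hdeg hdist hcurve ha (b := p₀) (c := p₁)
    (Y := r * p₀) (Z := 1) hp0 d₀ (by omega) hc one_ne_zero ?_
  linear_combination p₀ * key

theorem false_of_x_mul_y_mem_GRS {F ι : Type*} [Field F] [PerfectField F] [Fintype ι]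
    (h2 : (2 : F) ≠ 0) {f : F[X]} (hsf : Squarefree f) (hdeg : f.natDegree = 3)
    {α β a v : ι → F} (hdist : Function.Injective fun i => (α i, β i))
    (hcurve : ∀ i, β i ^ 2 = f.eval (α i))
    (ha : Function.Injective a) (hcard : 14 ≤ Fintype.card ι) {p₀ p₁ p₂ r : F[X]}
    (d₀ : p₀.natDegree ≤ 4) (d₁ : p₁.natDegree ≤ 4) (d₂ : p₂.natDegree ≤ 4)
    (dr : r.natDegree ≤ 4) (h₀ : ∀ i, 1 = v i * p₀.eval (a i))
    (h₁ : ∀ i, α i = v i * p₁.eval (a i)) (h₂ : ∀ i, α i ^ 2 = v i * p₂.eval (a i))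
    (hr : ∀ i, α i * β i = v i * r.eval (a i)) : False := by
  classical
  have hp0 : p₀ ≠ 0 := by
    rintro rfl
    have : Nonempty ι := Fintype.card_pos_iff.mp (by omega)
    simpa using h₀ (Classical.arbitrary ι)
  have hp1 : p₁ ≠ 0 := by
    rintro rfl
    have := card_filter_le_two hdist hcurve (s := Finset.univ) fun i _ j _ => by
      simp [h₁ i, h₁ j]
    rw [Finset.card_univ] at this
    omega
  have e : ∀ {x : F} {p : F[X]} {i}, x = v i * p.eval (a i) →
      p.eval (a i) = x * p₀.eval (a i) := fun {x p i} h => by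
    linear_combination p.eval (a i) * h₀ i - p₀.eval (a i) * h
  have k1 : p₀ * p₂ - p₁ ^ 2 = 0 := by
    refine eq_zero_of_natDegree_lt_card ha (d := 8) ?_ (by omega) fun i => ?_
    · exact (natDegree_sub_le _ _).trans (max_le (natDegree_mul_le.trans (by omega))
        (natDegree_pow_le_of_le 2 d₁))
    · simp only [eval_sub, eval_mul, eval_pow, e (h₁ i), e (h₂ i)]
      ring
  have dm : ∀ x y z : F[X], x.natDegree ≤ 4 → y.natDegree ≤ 4 → z.natDegree ≤ 4 →
      (x * y * z).natDegree ≤ 12 := fun x y z hx hy hz =>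
    natDegree_mul_le.trans (add_le_add (natDegree_mul_le.trans (add_le_add hx hy)) hz)
  have key : r * r * p₀ - (C (f.coeff 0) * (p₂ * p₀ * p₀) + C (f.coeff 1) * (p₂ * p₁ * p₀) +
      C (f.coeff 2) * (p₂ * p₂ * p₀) + C (f.coeff 3) * (p₂ * p₂ * p₁)) = 0 := by
    refine eq_zero_of_natDegree_lt_card ha (d := 12) ?_ (by omega) fun i => ?_
    · have dC : ∀ (s : F) (x y z : F[X]), x.natDegree ≤ 4 → y.natDegree ≤ 4 → z.natDegree ≤ 4 →
        (C s * (x * y * z)).natDegree ≤ 12 := fun s x y z hx hy hz =>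
          (natDegree_C_mul_le _ _).trans (dm x y z hx hy hz)
      refine (natDegree_sub_le _ _).trans (max_le (dm _ _ _ dr dr d₀) ?_)
      refine (natDegree_add_le _ _).trans (max_le ?_ (dC _ _ _ _ d₂ d₂ d₁))
      refine (natDegree_add_le _ _).trans (max_le ?_ (dC _ _ _ _ d₂ d₂ d₀))
      exact (natDegree_add_le _ _).trans (max_le (dC _ _ _ _ d₂ d₀ d₀) (dC _ _ _ _ d₂ d₁ d₀))
    · have hf := hcurve i
      rw [eval_cubic hdeg] at hf
      simp only [eval_sub, eval_mul, eval_add, eval_C, e (h₁ i), e (h₂ i), e (hr i)]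
      linear_combination α i ^ 2 * p₀.eval (a i) ^ 3 * hf
  refine false_of_rational_parametrization h2 hsf hdeg hdist hcurve ha (b := p₀) (c := p₁)
    (Y := r * p₀ ^ 2) (Z := p₁) hp0 d₀ (by omega) (fun i => e (h₁ i)) hp1 ?_
  rw [binaryForm_three]
  have k2 : p₀ * p₂ = p₁ ^ 2 := sub_eq_zero.mp k1
  linear_combination p₀ ^ 3 * key + (C (f.coeff 0) * p₀ ^ 4 + C (f.coeff 1) * p₁ * p₀ ^ 3 +
    (C (f.coeff 2) * p₀ ^ 2 + C (f.coeff 3) * p₁ * p₀) * (p₀ * p₂ + p₁ ^ 2)) * k2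

/-- Evaluation vectors orthogonal to all polynomials of degree less than `k` at `k + m + 1` nodes
come from polynomials of degree at most `m`. -/
theorem exists_eval_eq_of_orthogonal {F ι : Type*} [Field F] [Fintype ι] [DecidableEq ι]
    {a : ι → F} (ha : Function.Injective a) {k m : ℕ} (hcard : Fintype.card ι = k + m + 1)
    {y : ι → F} (hy : ∀ p : F[X], p.degree < k → ∑ i, y i * p.eval (a i) = 0) :
    ∃ r : F[X], r.natDegree ≤ m ∧
      ∀ i, (∏ j ∈ Finset.univ.erase i, (a i - a j)) * y i = r.eval (a i) := by
  set w : ι → F := fun i => ∏ j ∈ Finset.univ.erase i, (a i - a j)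
  have hw : ∀ i, w i ≠ 0 := fun i => Finset.prod_ne_zero_iff.mpr fun j hj =>
    sub_ne_zero.mpr fun h => (Finset.mem_erase.mp hj).1 (ha h).symm
  set r := Lagrange.interpolate Finset.univ a fun i => w i * y i
  have hr : ∀ i, w i * y i = r.eval (a i) := fun i =>
    (Lagrange.eval_interpolate_at_node (fun i => w i * y i) ha.injOn (Finset.mem_univ i)).symm
  refine ⟨r, ?_, hr⟩
  by_contra! hlt
  have hr0 : r ≠ 0 := by rintro h; simp [h] at hlt
  have hdeg : r.natDegree < Fintype.card ι := by
    rw [natDegree_lt_iff_degree_lt hr0, ← Finset.card_univ]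
    exact Lagrange.degree_interpolate_lt _ ha.injOn
  set s := Fintype.card ι - 1 - r.natDegree
  have hnd : (r * X ^ s).natDegree = Fintype.card ι - 1 := by
    rw [natDegree_mul_X_pow _ hr0]; omega
  have hsum := Lagrange.coeff_eq_sum (s := Finset.univ) (v := a) ha.injOn (P := r * X ^ s) (by
    rw [Finset.card_univ]
    exact (degree_le_natDegree).trans_lt (by rw [hnd]; exact_mod_cast (by omega)))
  have horth := hy (X ^ s) (by rw [degree_X_pow]; exact_mod_cast (by omega))
  rw [Finset.card_univ, ← hnd, coeff_natDegree] at hsum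
  refine leadingCoeff_ne_zero.mpr (mul_ne_zero hr0 (pow_ne_zero s X_ne_zero)) ?_
  rw [hsum, ← horth]
  refine Finset.sum_congr rfl fun i _ => ?_
  rw [eval_mul, ← hr, div_eq_iff (hw i)]
  ring

/-- The indices of the points `(α i, β i)` whose conjugate `(α i, -β i)` is not one of the
points. -/
def unpaired {F ι : Type*} [Field F] [Fintype ι] [DecidableEq F] (α β : ι → F) : Finset ι :=
  Finset.univ.filter fun i => ∀ j, α j = α i → β j ≠ -β i

theorem fiber_cases {F ι : Type*} [Field F] [Fintype ι] [DecidableEq F] [DecidableEq ι]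
    (h2 : (2 : F) ≠ 0) {f : F[X]} {α β : ι → F}
    (hdist : Function.Injective fun i => (α i, β i)) (hβ : ∀ i, β i ≠ 0)
    (hcurve : ∀ i, β i ^ 2 = f.eval (α i)) (i : ι) :
    (i ∈ unpaired α β ∧ (Finset.univ.filter fun j => α j = α i) = {i}) ∨
      ∃ j, j ≠ i ∧ i ∉ unpaired α β ∧ j ∉ unpaired α β ∧ α j = α i ∧ β j = -β i ∧
        (Finset.univ.filter fun j => α j = α i) = {i, j} := by
  have hpm : ∀ j, α j = α i → j = i ∨ β j = -β i := fun j hj => by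
    have : β j ^ 2 = β i ^ 2 := by rw [hcurve, hcurve, hj]
    exact (sq_eq_sq_iff_eq_or_eq_neg.mp this).imp (fun h => hdist (Prod.ext hj h)) id
  by_cases hi : i ∈ unpaired α β
  · refine .inl ⟨hi, ?_⟩
    ext j
    simp only [Finset.mem_filter, Finset.mem_univ, true_and, Finset.mem_singleton]
    refine ⟨fun hj => (hpm j hj).resolve_right ((Finset.mem_filter.mp hi).2 j hj), ?_⟩
    rintro rfl; rfl
  · obtain ⟨j, hj, hji⟩ : ∃ j, α j = α i ∧ β j = -β i := by
      simpa [unpaired] using hi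
    refine .inr ⟨j, ?_, hi, ?_, hj, hji, ?_⟩
    · rintro rfl
      exact mul_ne_zero h2 (hβ j) (by linear_combination hji)
    · simp only [unpaired, Finset.mem_filter, Finset.mem_univ, true_and, not_forall, not_not]
      exact ⟨i, hj.symm, by rw [hji, neg_neg]⟩
    · ext l
      simp only [Finset.mem_filter, Finset.mem_univ, true_and, Finset.mem_insert,
        Finset.mem_singleton]
      constructor
      · exact fun hl => (hpm l hl).imp id fun h =>
          hdist (Prod.ext (hl.trans hj.symm) (h.trans hji.symm))
      · rintro (rfl | rfl)
        exacts [rfl, hj]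

theorem card_add_card_unpaired {F ι : Type*} [Field F] [Fintype ι] [DecidableEq F]
    (h2 : (2 : F) ≠ 0) {f : F[X]} {α β : ι → F}
    (hdist : Function.Injective fun i => (α i, β i)) (hβ : ∀ i, β i ≠ 0)
    (hcurve : ∀ i, β i ^ 2 = f.eval (α i)) :
    Fintype.card ι + (unpaired α β).card = 2 * (Finset.univ.image α).card := by
  classical
  rw [← Finset.card_univ, Finset.card_eq_sum_card_image α Finset.univ,
    Finset.card_eq_sum_card_fiberwise (s := unpaired α β) (t := Finset.univ.image α) (f := α)
      (fun i _ => by simp), ← Finset.sum_add_distrib, mul_comm, ← smul_eq_mul,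
    ← Finset.sum_const]
  refine Finset.sum_congr rfl fun x hx => ?_
  obtain ⟨i, -, rfl⟩ := Finset.mem_image.mp hx
  have e : ((unpaired α β).filter fun j => α j = α i) =
      (Finset.univ.filter fun j => α j = α i).filter (· ∈ unpaired α β) := by
    ext j; simp [and_comm]
  rw [e]
  rcases fiber_cases h2 hdist hβ hcurve i with ⟨hi, h⟩ | ⟨j, hji, hi, hj, -, -, h⟩
  · rw [h, Finset.filter_singleton, if_pos hi]; rfl
  · rw [h, Finset.card_pair hji.symm, Finset.filter_insert, Finset.filter_singleton, if_neg hi,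
      if_neg hj]; rfl

theorem injOn_unpaired {F ι : Type*} [Field F] [Fintype ι] [DecidableEq F]
    (h2 : (2 : F) ≠ 0) {f : F[X]} {α β : ι → F}
    (hdist : Function.Injective fun i => (α i, β i)) (hβ : ∀ i, β i ≠ 0)
    (hcurve : ∀ i, β i ^ 2 = f.eval (α i)) : Set.InjOn α (unpaired α β) := by
  classical
  intro i hi j _ hij
  rcases fiber_cases h2 hdist hβ hcurve i with ⟨_, h⟩ | ⟨_, _, hi', _⟩
  · have : j ∈ Finset.univ.filter fun j => α j = α i := by simp [hij]
    rw [h] at this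
    exact (Finset.mem_singleton.mp this).symm
  · exact absurd hi hi'

/-- A residue theorem for the differential `(c + d y) dx / (h y)`, where `h` vanishes simply at
the abscissas of the points and `c + d y` vanishes at the conjugates of unpaired points. -/
theorem sum_residues_eq_zero {F ι : Type*} [Field F] [Fintype ι] [DecidableEq F]
    (h2 : (2 : F) ≠ 0) {f : F[X]} {α β : ι → F}
    (hdist : Function.Injective fun i => (α i, β i)) (hβ : ∀ i, β i ≠ 0)
    (hcurve : ∀ i, β i ^ 2 = f.eval (α i)) {c d : F[X]}
    (hT : ∀ i ∈ unpaired α β, c.eval (α i) = d.eval (α i) * β i)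
    (hd : d.degree < ((Finset.univ.image α).card - 1 : ℕ)) :
    ∑ i, (c.eval (α i) + d.eval (α i) * β i) /
      (β i * ∏ x ∈ (Finset.univ.image α).erase (α i), (α i - x)) = 0 := by
  classical
  have hcoeff : d.coeff ((Finset.univ.image α).card - 1) = 0 := coeff_eq_zero_of_degree_lt hd
  rw [Lagrange.coeff_eq_sum (v := id) Function.injective_id.injOn
    (hd.trans_le (by exact_mod_cast Nat.sub_le _ _))] at hcoeff
  rw [← Finset.sum_fiberwise_of_maps_to (s := Finset.univ) (t := Finset.univ.image α) (g := α)
    (fun i _ => by simp), ← mul_zero (2 : F), ← hcoeff, Finset.mul_sum]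
  refine Finset.sum_congr rfl fun x hx => ?_
  obtain ⟨i, -, rfl⟩ := Finset.mem_image.mp hx
  have hi0 := hβ i
  have hw : ∏ x ∈ (Finset.univ.image α).erase (α i), (α i - x) ≠ 0 :=
    Finset.prod_ne_zero_iff.mpr fun j hj => sub_ne_zero.mpr (Finset.mem_erase.mp hj).1.symm
  simp only [id]
  rcases fiber_cases h2 hdist hβ hcurve i with ⟨hi, h⟩ | ⟨j, hji, -, -, hα, hβj, h⟩
  · rw [h, Finset.sum_singleton, hT i hi]
    field_simp
    ring
  · rw [h, Finset.sum_pair hji.symm, hα, hβj]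
    field_simp
    ring

theorem degree_mul_lt_of_lt {R : Type*} [CommRing R] [IsDomain R] {p q : R[X]} {i j m : ℕ}
    (hp : p.degree < i) (hq : q.degree < j) (h : i + j ≤ m + 1) : (p * q).degree < m := by
  rcases eq_or_ne p 0 with rfl | hp0
  · simp [bot_lt_iff_ne_bot]
  rcases eq_or_ne q 0 with rfl | hq0
  · simp [bot_lt_iff_ne_bot]
  rw [← natDegree_lt_iff_degree_lt hp0] at hp
  rw [← natDegree_lt_iff_degree_lt hq0] at hq
  rw [← natDegree_lt_iff_degree_lt (mul_ne_zero hp0 hq0), natDegree_mul hp0 hq0]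
  omega

theorem exists_ne_zero_vanishing {F ι : Type*} [Field F] (T : Finset ι) (α β : ι → F) {i j : ℕ}
    (h : T.card < i + j) : ∃ c d : F[X], c.degree < i ∧ d.degree < j ∧ (c ≠ 0 ∨ d ≠ 0) ∧
      ∀ l ∈ T, c.eval (α l) = d.eval (α l) * β l := by
  let φ : (degreeLT F i × degreeLT F j) →ₗ[F] (T → F) :=
    LinearMap.pi fun l => ((leval (α l)).comp (Submodule.subtype _)).comp (LinearMap.fst F _ _) -
      β l • ((leval (α l)).comp (Submodule.subtype _)).comp (LinearMap.snd F _ _)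
  have hfin : Module.finrank F (T → F) < Module.finrank F (degreeLT F i × degreeLT F j) := by
    rw [Module.finrank_prod, (degreeLTEquiv F i).finrank_eq, (degreeLTEquiv F j).finrank_eq]
    simpa using h
  have := (degreeLTEquiv F i).symm.finiteDimensional
  have := (degreeLTEquiv F j).symm.finiteDimensional
  obtain ⟨⟨⟨c, hc⟩, ⟨d, hd⟩⟩, hker, hne⟩ :=
    Submodule.exists_mem_ne_zero_of_ne_bot (LinearMap.ker_ne_bot_of_finrank_lt (f := φ) hfin)
  refine ⟨c, d, mem_degreeLT.mp hc, mem_degreeLT.mp hd, ?_, fun l hl => ?_⟩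
  · by_contra! hcd
    exact hne (by simp [hcd.1, hcd.2])
  · have := congrFun (LinearMap.mem_ker.mp hker) ⟨l, hl⟩
    simp [φ] at this
    linear_combination this

theorem natDegree_lt_of_degree_lt_of_pos {R : Type*} [Semiring R] {p : R[X]} {n : ℕ}
    (h : p.degree < n) (hn : 0 < n) : p.natDegree < n := by
  rcases eq_or_ne p 0 with rfl | hp
  · simpa using hn
  · exact (natDegree_lt_iff_degree_lt hp).mpr h

/-- The degree of the norm of `c + d y` on the curve `y ^ 2 = f x`. -/
theorem natDegree_sq_sub_mul_sq {F : Type*} [Field F] [DecidableEq F] {f : F[X]}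
    (hdeg : f.natDegree = 3) (c d : F[X]) :
    (c ^ 2 - f * d ^ 2).natDegree =
      max (2 * c.natDegree) (if d = 0 then 0 else 3 + 2 * d.natDegree) := by
  have hf : f ≠ 0 := by rintro rfl; simp at hdeg
  split_ifs with hd
  · simp [hd, natDegree_pow]
  · have h1 : (c ^ 2).natDegree = 2 * c.natDegree := natDegree_pow _ _
    have h2 : (f * d ^ 2).natDegree = 3 + 2 * d.natDegree := by
      rw [natDegree_mul hf (pow_ne_zero 2 hd), natDegree_pow, hdeg]
    rcases lt_or_gt_of_ne (show 2 * c.natDegree ≠ 3 + 2 * d.natDegree by omega) with h | h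
    · rw [natDegree_sub_eq_right_of_natDegree_lt (by omega), h2, max_eq_right h.le]
    · rw [natDegree_sub_eq_left_of_natDegree_lt (by omega), h1, max_eq_left h.le]

theorem sq_sub_mul_sq_ne_zero {F : Type*} [Field F] {f : F[X]} (hdeg : f.natDegree = 3)
    {c d : F[X]} (h : c ≠ 0 ∨ d ≠ 0) : c ^ 2 - f * d ^ 2 ≠ 0 := by
  classical
  intro h0
  have hN := natDegree_sq_sub_mul_sq hdeg c d
  rw [h0, natDegree_zero] at hN
  split_ifs at hN with hd
  · rw [hd] at h0
    simp only [ne_eq, hd, not_true_eq_false, or_false] at h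
    exact h (by simpa using h0)
  · omega

theorem prod_X_sub_C_dvd_of_injOn {F ι : Type*} [Field F] {T : Finset ι} {α : ι → F}
    (hinj : Set.InjOn α T) {p : F[X]} (hp : ∀ i ∈ T, p.eval (α i) = 0) :
    ∏ i ∈ T, (X - C (α i)) ∣ p :=
  Finset.prod_dvd_of_coprime (fun _ hi _ hj hij =>
    isCoprime_X_sub_C_of_isUnit_sub (sub_ne_zero.mpr fun h => hij (hinj hi hj h)).isUnit)
    fun i hi => dvd_iff_isRoot.mpr (hp i hi)

theorem natDegree_le_of_degree_monic_mul_lt {R : Type*} [CommRing R] {h q : R[X]} {m : ℕ}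
    (hh : h.Monic) (hlt : (h * q).degree < (h.natDegree + m + 1 : ℕ)) : q.natDegree ≤ m := by
  have := natDegree_lt_of_degree_lt_of_pos hlt (by omega)
  rcases eq_or_ne q 0 with rfl | hq
  · simp
  · rw [hh.natDegree_mul' hq] at this
    omega

/-- If a generalized Reed-Solomon code of codimension `4` is contained in the code of a space of
functions on the curve, then a fixed multiplier turns the functions vanishing at the conjugates of
the unpaired points, of suitable degree, into polynomials of degree at most `3`. -/
theorem exists_multiplier {F ι : Type*} [Field F] [Fintype ι] [DecidableEq F]
    (h2 : (2 : F) ≠ 0) {f : F[X]} {α β a v : ι → F}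
    (hdist : Function.Injective fun i => (α i, β i)) (hβ : ∀ i, β i ≠ 0)
    (hcurve : ∀ i, β i ^ 2 = f.eval (α i)) (ha : Function.Injective a) (hv : ∀ i, v i ≠ 0)
    {j e : ℕ} (hcard : Fintype.card ι = 2 * j + 1 + 3 + 1) (he : 1 ≤ e)
    (hr : (Finset.univ.image α).card = e + j + 1)
    (hsub : ∀ p : F[X], p.degree < (2 * j + 1 : ℕ) → ∃ c d : F[X], c.degree < (j + 2 : ℕ) ∧
      d.degree < j ∧ ∀ i, v i * p.eval (a i) = c.eval (α i) + d.eval (α i) * β i) :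
    ∃ μ : ι → F, (∀ i, μ i ≠ 0) ∧ ∀ c d : F[X], c.degree < (e + 1 : ℕ) → d.degree < (e - 1 : ℕ) →
      (∀ i ∈ unpaired α β, c.eval (α i) = d.eval (α i) * β i) →
      ∃ ρ : F[X], ρ.natDegree ≤ 3 ∧
        ∀ i, μ i * (c.eval (α i) + d.eval (α i) * β i) = ρ.eval (a i) := by
  classical
  set D : ι → F := fun i => β i * ∏ x ∈ (Finset.univ.image α).erase (α i), (α i - x)
  have hD : ∀ i, D i ≠ 0 := fun i => mul_ne_zero (hβ i) (Finset.prod_ne_zero_iff.mpr fun x hx =>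
    sub_ne_zero.mpr (Finset.mem_erase.mp hx).1.symm)
  refine ⟨fun i => (∏ l ∈ Finset.univ.erase i, (a i - a l)) * (v i / D i), fun i =>
    mul_ne_zero (Finset.prod_ne_zero_iff.mpr fun l hl => sub_ne_zero.mpr fun h =>
      (Finset.mem_erase.mp hl).1 (ha h).symm) (div_ne_zero (hv i) (hD i)), fun c d hc hd hT => ?_⟩
  obtain ⟨ρ, hρ, h⟩ := exists_eval_eq_of_orthogonal ha (k := 2 * j + 1) (m := 3) hcard
    (y := fun i => v i / D i * (c.eval (α i) + d.eval (α i) * β i)) fun p hp => by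
      obtain ⟨c', d', hc', hd', h⟩ := hsub p hp
      refine Eq.trans ?_ (sum_residues_eq_zero h2 hdist hβ hcurve
        (c := c * c' + f * (d * d')) (d := c * d' + d * c') (fun i hi => ?_) ?_)
      · refine Finset.sum_congr rfl fun i _ => ?_
        rw [div_mul_eq_mul_div, div_mul_eq_mul_div]
        congr 1
        simp only [eval_add, eval_mul, ← hcurve]
        linear_combination (c.eval (α i) + d.eval (α i) * β i) * h i
      · simp only [eval_add, eval_mul, ← hcurve, hT i hi]
        ring
      · exact (degree_add_le _ _).trans_lt (max_lt (degree_mul_lt_of_lt hc hd' (by omega))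
          (degree_mul_lt_of_lt hd hc' (by omega)))
  exact ⟨ρ, hρ, fun i => by rw [← h]; ring⟩

theorem eq_zero_of_forall_add_mul_eq_zero {F ι : Type*} [Field F] [Fintype ι] [DecidableEq F]
    (h2 : (2 : F) ≠ 0) {f : F[X]} {α β : ι → F}
    (hdist : Function.Injective fun i => (α i, β i)) (hβ : ∀ i, β i ≠ 0)
    (hcurve : ∀ i, β i ^ 2 = f.eval (α i)) {c d : F[X]}
    (hc : c.degree < ((Finset.univ.image α).card : ℕ))
    (hd : d.degree < ((Finset.univ.image α).card : ℕ))
    (hT : ∀ i ∈ unpaired α β, c.eval (α i) = d.eval (α i) * β i)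
    (h : ∀ i, c.eval (α i) + d.eval (α i) * β i = 0) : c = 0 ∧ d = 0 := by
  classical
  have hminus : ∀ i, c.eval (α i) = d.eval (α i) * β i := fun i => by
    rcases fiber_cases h2 hdist hβ hcurve i with ⟨hi, -⟩ | ⟨l, -, -, -, hl, hβl, -⟩
    · exact hT i hi
    · have := h l
      rw [hl, hβl] at this
      linear_combination this
  have hd0 : ∀ i, d.eval (α i) = 0 := fun i => by
    refine (mul_eq_zero.mp (?_ : d.eval (α i) * (2 * β i) = 0)).resolve_right
      (mul_ne_zero h2 (hβ i))
    linear_combination h i - hminus i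
  refine ⟨eq_zero_of_degree_lt_of_eval_finset_eq_zero _ hc fun x hx => ?_,
    eq_zero_of_degree_lt_of_eval_finset_eq_zero _ hd fun x hx => ?_⟩
  all_goals obtain ⟨i, -, rfl⟩ := Finset.mem_image.mp hx
  · rw [hminus, hd0, zero_mul]
  · exact hd0 i

/-- A short function on the curve and a second one, both vanishing at the points of `T`, whose norms
have degrees of opposite parity. -/
theorem exists_pair_of_norms_of_opposite_parity {F ι : Type*} [Field F] {f : F[X]}
    (hdeg : f.natDegree = 3) {α β : ι → F} (hcurve : ∀ i, β i ^ 2 = f.eval (α i)) {T : Finset ι}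
    (hinj : Set.InjOn α T) {e : ℕ} (he : T.card + 3 = 2 * e) :
    ∃ c d c' d' : F[X], (c ≠ 0 ∨ d ≠ 0) ∧ c.degree < e ∧ d.degree < (e - 2 : ℕ) ∧
      (∀ i ∈ T, c.eval (α i) = d.eval (α i) * β i) ∧
      c'.degree < (e + 1 : ℕ) ∧ d'.degree < (e - 1 : ℕ) ∧
      (∀ i ∈ T, c'.eval (α i) = d'.eval (α i) * β i) ∧
      ¬ Even ((c' ^ 2 - f * d' ^ 2) * (c ^ 2 - f * d ^ 2)).natDegree := by
  classical
  obtain ⟨c, d, hc, hd, h0, hT⟩ := exists_ne_zero_vanishing T α β (i := e) (j := e - 2) (by omega)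
  have hN0 := sq_sub_mul_sq_ne_zero hdeg h0
  have hle : ∀ {c d : F[X]}, (c ≠ 0 ∨ d ≠ 0) → (∀ i ∈ T, c.eval (α i) = d.eval (α i) * β i) →
      T.card ≤ (c ^ 2 - f * d ^ 2).natDegree := fun {c d} h h' => by
    have := natDegree_le_of_dvd (prod_X_sub_C_dvd_of_injOn hinj (p := c ^ 2 - f * d ^ 2)
      fun i hi => by simp [h' i hi, ← hcurve]; ring) (sq_sub_mul_sq_ne_zero hdeg h)
    rwa [natDegree_finsetProd_X_sub_C_eq_card] at this
  by_cases hev : Even (c ^ 2 - f * d ^ 2).natDegree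
  · obtain ⟨c', d', hc', hd', h0', hT'⟩ :=
      exists_ne_zero_vanishing T α β (i := e - 1) (j := e - 1) (by omega)
    refine ⟨c, d, c', d', h0, hc, hd, hT, hc'.trans_le (by exact_mod_cast (by omega)), hd', hT', ?_⟩
    rw [natDegree_mul (sq_sub_mul_sq_ne_zero hdeg h0') hN0, Nat.even_add]
    have h1 := natDegree_lt_of_degree_lt_of_pos hc' (by omega)
    have h3 := hle h0' hT'
    have h4 := natDegree_sq_sub_mul_sq hdeg c' d'
    simp only [hev, iff_true, Nat.even_iff]
    split_ifs at h4 <;> omega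
  · obtain ⟨c', d', hc', hd', h0', hT'⟩ :=
      exists_ne_zero_vanishing T α β (i := e + 1) (j := e - 3) (by omega)
    refine ⟨c, d, c', d', h0, hc, hd, hT, hc', hd'.trans_le (by exact_mod_cast (by omega)), hT', ?_⟩
    rw [natDegree_mul (sq_sub_mul_sq_ne_zero hdeg h0') hN0, Nat.even_add]
    have h3 := hle h0' hT'
    have h4 := natDegree_sq_sub_mul_sq hdeg c' d'
    simp only [hev, iff_false, Nat.even_iff, not_not]
    split_ifs at h4 with h5
    · omega
    · have := (natDegree_lt_iff_degree_lt h5).mpr hd'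
      omega

/-- The quadratic relation between two functions `c + d y` and `c' + d' y` on the curve
`y ^ 2 = f x` whose norms share the factor `h` with their mixed products. -/
theorem quadratic_relation {R : Type*} [CommRing R] [IsDomain R] {f h c d c' d' L M q δ : R}
    (hh : h ≠ 0) (hL : c ^ 2 - f * d ^ 2 = h * L) (hM : c' ^ 2 - f * d' ^ 2 = h * M)
    (hq : c' * c - f * d' * d = h * q) (hδ : d' * c - c' * d = h * δ) :
    q ^ 2 - L * M = f * δ ^ 2 ∧
      L * (c' ^ 2 + f * d' ^ 2) - 2 * q * (c' * c + f * d' * d) + M * (c ^ 2 + f * d ^ 2) = 0 ∧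
      L * (2 * c' * d') - 2 * q * (c' * d + d' * c) + M * (2 * c * d) = 0 := by
  refine ⟨mul_left_cancel₀ (pow_ne_zero 2 hh) ?_, mul_left_cancel₀ hh ?_, mul_left_cancel₀ hh ?_⟩
  · linear_combination -(c' * c - f * d' * d + h * q) * hq + (h * M) * hL +
      (c ^ 2 - f * d ^ 2) * hM + f * (d' * c - c' * d + h * δ) * hδ
  · linear_combination -(c' ^ 2 + f * d' ^ 2) * hL + 2 * (c' * c + f * d' * d) * hq -
      (c ^ 2 + f * d ^ 2) * hM
  · linear_combination -(2 * c' * d') * hL + 2 * (c' * d + d' * c) * hq - (2 * c * d) * hM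

/-- A generalized Reed-Solomon code of dimension `2 * j + 1` and length `2 * j + 5` is not contained
in the code of the functions `c + d y` on the curve with `c.degree < j + 2`, `d.degree < j`. -/
theorem false_of_GRS_le_curve_code {F ι : Type*} [Field F] [PerfectField F] [Fintype ι]
    (h2 : (2 : F) ≠ 0) {f : F[X]} (hsf : Squarefree f) (hdeg : f.natDegree = 3)
    {α β a v : ι → F} (hdist : Function.Injective fun i => (α i, β i)) (hβ : ∀ i, β i ≠ 0)
    (hcurve : ∀ i, β i ^ 2 = f.eval (α i)) (ha : Function.Injective a) (hv : ∀ i, v i ≠ 0)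
    {j : ℕ} (hj : 3 ≤ j) (hcard : Fintype.card ι = 2 * j + 5)
    (hsub : ∀ p : F[X], p.degree < (2 * j + 1 : ℕ) → ∃ c d : F[X], c.degree < (j + 2 : ℕ) ∧
      d.degree < j ∧ ∀ i, v i * p.eval (a i) = c.eval (α i) + d.eval (α i) * β i) :
    False := by
  classical
  set T := unpaired α β
  have hinj : Set.InjOn α T := injOn_unpaired h2 hdist hβ hcurve
  have hrt : Fintype.card ι + T.card = 2 * (Finset.univ.image α).card :=
    card_add_card_unpaired h2 hdist hβ hcurve
  have htr : T.card ≤ (Finset.univ.image α).card := by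
    rw [← Finset.card_image_of_injOn hinj]
    exact Finset.card_le_card (Finset.image_subset_image (Finset.subset_univ _))
  obtain ⟨e, hr⟩ : ∃ e, (Finset.univ.image α).card = e + j + 1 :=
    ⟨(Finset.univ.image α).card - (j + 1), by omega⟩
  have he : T.card + 3 = 2 * e := by omega
  obtain ⟨μ, hμ, hdual⟩ := exists_multiplier h2 hdist hβ hcurve ha hv (e := e) hcard
    (by omega) hr hsub
  obtain ⟨c, d, c', d', h0, hc, hd, hT, hc', hd', hT', hodd⟩ :=
    exists_pair_of_norms_of_opposite_parity hdeg hcurve hinj he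
  set h := ∏ i ∈ T, (X - C (α i))
  have hmonic : h.Monic := monic_prod_of_monic _ _ fun i _ => monic_X_sub_C _
  have hhd : h.natDegree = T.card := natDegree_finsetProd_X_sub_C_eq_card _ _
  have hdvd : ∀ {p : F[X]}, (∀ i ∈ T, p.eval (α i) = 0) → h ∣ p := prod_X_sub_C_dvd_of_injOn hinj
  have hf : f.degree < (4 : ℕ) := by
    rw [degree_eq_natDegree hsf.ne_zero, hdeg]; exact_mod_cast (by omega)
  obtain ⟨L, hL⟩ := hdvd (p := c ^ 2 - f * d ^ 2) fun i hi => by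
    simp [hT i hi, ← hcurve]; ring
  obtain ⟨M, hM⟩ := hdvd (p := c' ^ 2 - f * d' ^ 2) fun i hi => by
    simp [hT' i hi, ← hcurve]; ring
  obtain ⟨q, hq⟩ := hdvd (p := c' * c - f * d' * d) fun i hi => by
    simp [hT i hi, hT' i hi, ← hcurve]; ring
  obtain ⟨δ, hδ⟩ := hdvd (p := d' * c - c' * d) fun i hi => by
    simp [hT i hi, hT' i hi]; ring
  have hsub' : ∀ {x y : F[X]} {m : ℕ}, x.degree < m → y.degree < m → (x - y).degree < m :=
    fun hx hy => (degree_sub_le _ _).trans_lt (max_lt hx hy)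
  have dL : L.natDegree ≤ 1 := natDegree_le_of_degree_monic_mul_lt hmonic <| by
    rw [← hL, hhd, pow_two, pow_two]
    exact hsub' (degree_mul_lt_of_lt hc hc (by omega)) (degree_mul_lt_of_lt hf
      (degree_mul_lt_of_lt (m := 2 * e - 5) hd hd (by omega)) (by omega))
  have dM : M.natDegree ≤ 3 := natDegree_le_of_degree_monic_mul_lt hmonic <| by
    rw [← hM, hhd, pow_two, pow_two]
    exact hsub' (degree_mul_lt_of_lt hc' hc' (by omega)) (degree_mul_lt_of_lt hf
      (degree_mul_lt_of_lt (m := 2 * e - 3) hd' hd' (by omega)) (by omega))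
  have dq : q.natDegree ≤ 2 := natDegree_le_of_degree_monic_mul_lt hmonic <| by
    rw [← hq, hhd, mul_assoc]
    exact hsub' (degree_mul_lt_of_lt hc' hc (by omega)) (degree_mul_lt_of_lt hf
      (degree_mul_lt_of_lt (m := 2 * e - 4) hd' hd (by omega)) (by omega))
  have dδ : δ.natDegree ≤ 0 := natDegree_le_of_degree_monic_mul_lt hmonic <| by
    rw [← hδ, hhd]
    exact hsub' (degree_mul_lt_of_lt hd' hc (by omega)) (degree_mul_lt_of_lt hc' hd (by omega))
  have hδC := eq_C_of_natDegree_le_zero dδ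
  obtain ⟨hdisc, hrel₀, hrel₁⟩ := quadratic_relation hmonic.ne_zero hL hM hq hδ
  have hδ0 : δ ≠ 0 := by
    rintro rfl
    refine hodd ?_
    rw [show (c' ^ 2 - f * d' ^ 2) * (c ^ 2 - f * d ^ 2) = (h * q) ^ 2 by
      rw [hL, hM]; linear_combination -h ^ 2 * hdisc, natDegree_pow]
    exact even_two_mul _
  have hX : (X : F[X]).degree < (2 : ℕ) := by rw [degree_X]; exact_mod_cast one_lt_two
  obtain ⟨b, db, hb⟩ := hdual c d (hc.trans_le (by exact_mod_cast (by omega)))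
    (hd.trans_le (by exact_mod_cast (by omega))) hT
  obtain ⟨g, dg, hg⟩ := hdual (X * c) (X * d) (degree_mul_lt_of_lt hX hc (by omega))
    (degree_mul_lt_of_lt hX hd (by omega)) fun i hi => by simp [hT i hi, mul_assoc]
  obtain ⟨κ, dκ, hκ⟩ := hdual c' d' hc' hd' hT'
  have hgb : ∀ i, g.eval (a i) = α i * b.eval (a i) := fun i => by
    rw [← hg, ← hb]; simp only [eval_mul, eval_X]; ring
  have hb0 : b ≠ 0 := by
    rintro rfl
    obtain ⟨rfl, rfl⟩ := eq_zero_of_forall_add_mul_eq_zero h2 hdist hβ hcurve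
      (hc.trans_le (by exact_mod_cast (by omega))) (hd.trans_le (by exact_mod_cast (by omega))) hT
      fun i => by simpa [hμ i] using hb i
    simp at h0
  have key : binaryForm 1 L g b * κ ^ 2 - 2 * (binaryForm 2 q g b * κ) + binaryForm 3 M g b = 0 := by
    refine eq_zero_of_natDegree_lt_card ha (d := 9) ?_ (by omega) fun i => ?_
    · have e1 := natDegree_binaryForm_le 1 L dg db
      have e2 := natDegree_binaryForm_le 2 q dg db
      have e3 := natDegree_binaryForm_le 3 M dg db
      have e4 := natDegree_pow_le_of_le 2 dκ
      refine (natDegree_add_le _ _).trans (max_le ((natDegree_sub_le _ _).trans (max_le ?_ ?_)) e3)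
      · exact natDegree_mul_le.trans (by omega)
      · refine (natDegree_C_mul_le (2 : F) _).trans (natDegree_mul_le.trans (by omega))
    · have r0 := congrArg (eval (α i)) hrel₀
      have r1 := congrArg (eval (α i)) hrel₁
      simp only [eval_add, eval_sub, eval_mul, eval_pow, eval_zero, eval_ofNat, ← hcurve] at r0 r1
      simp only [eval_add, eval_sub, eval_mul, eval_pow, eval_ofNat, eval_binaryForm dL (hgb i),
        eval_binaryForm dq (hgb i), eval_binaryForm dM (hgb i), ← hb, ← hκ]
      linear_combination μ i ^ 3 * (c.eval (α i) + d.eval (α i) * β i) * (r0 + β i * r1)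
  have hform : binaryForm 2 q g b ^ 2 - binaryForm 1 L g b * binaryForm 3 M g b =
      δ ^ 2 * (b * binaryForm 3 f g b) := by
    rw [pow_two, ← binaryForm_mul dq dq, ← binaryForm_mul dL dM, ← binaryForm_sub, ← pow_two,
      hdisc, hδC, ← C_pow, mul_comm f, binaryForm_C_mul, binaryForm_succ hdeg.le]
  refine false_of_rational_parametrization h2 hsf hdeg hdist hcurve ha (b := b) (c := g)
    (Y := binaryForm 1 L g b * κ - binaryForm 2 q g b) (Z := δ) hb0 db (by omega) hgb hδ0 ?_
  linear_combination binaryForm 1 L g b * key + hform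

theorem exists_polynomials_of_mem_span {F : Type*} [Field F] {n : ℕ} {α β : Fin n → F} {j ℓ : ℕ}
    {η : F} {c : Fin n → F}
    (hc : c ∈ Submodule.span F (Set.range (Sum.elim
      (fun (a : Fin (j + 1)) => fun i => α i ^ (a : ℕ))
      (fun (b : Fin j) => fun i => α i ^ (b : ℕ) * β i +
        if (b : ℕ) = ℓ then η * α i ^ (j + 1) else 0)))) :
    ∃ p q : F[X], p.degree < (j + 2 : ℕ) ∧ q.degree < j ∧
      ∀ i, c i = p.eval (α i) + q.eval (α i) * β i := by
  induction hc using Submodule.span_induction with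
  | mem x hx =>
    obtain ⟨s | s, rfl⟩ := hx
    · refine ⟨X ^ (s : ℕ), 0, ?_, by simp, fun i => by simp⟩
      rw [degree_X_pow]; exact_mod_cast (by omega)
    · refine ⟨if (s : ℕ) = ℓ then C η * X ^ (j + 1) else 0, X ^ (s : ℕ), ?_, ?_, fun i => ?_⟩
      · split_ifs
        · exact (degree_C_mul_X_pow_le _ _).trans_lt (by exact_mod_cast (by omega))
        · simp [bot_lt_iff_ne_bot]
      · rw [degree_X_pow]; exact_mod_cast s.2
      · simp only [Sum.elim_inr]
        split_ifs <;> simp [add_comm]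
  | zero => exact ⟨0, 0, by simp [bot_lt_iff_ne_bot], by simp [bot_lt_iff_ne_bot], by simp⟩
  | add x y _ _ hx hy =>
    obtain ⟨p, q, hp, hq, h⟩ := hx
    obtain ⟨p', q', hp', hq', h'⟩ := hy
    exact ⟨p + p', q + q', (degree_add_le _ _).trans_lt (max_lt hp hp'),
      (degree_add_le _ _).trans_lt (max_lt hq hq'), fun i => by
        simp only [Pi.add_apply, h, h', eval_add]; ring⟩
  | smul r x _ hx =>
    obtain ⟨p, q, hp, hq, h⟩ := hx
    exact ⟨r • p, r • q, (degree_smul_le _ _).trans_lt hp, (degree_smul_le _ _).trans_lt hq,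
      fun i => by simp only [Pi.smul_apply, h, eval_smul, smul_eq_mul]; ring⟩

theorem stmt_17 (F : Type*) [Field F] [Fintype F] (hchar : ringChar F ≠ 2)
    (f : F[X]) (hsf : Squarefree f) (hdeg : f.natDegree = 3)
    (n : ℕ) (α β : Fin n → F)
    (hdist : Function.Injective (fun i => (α i, β i)))
    (hβ0 : ∀ i, β i ≠ 0)
    (hcurve : ∀ i, β i ^ 2 = f.eval (α i))
    (k : ℕ) (hk : Odd k)
    (hkr : (4 ≤ k ∧ k ≤ (n - 4) / 2) ∨ ((n + 4) / 2 ≤ k ∧ k ≤ n - 4))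
    (ℓ : ℕ) (hℓ : ℓ ≤ (k - 3) / 2) (η : F) (hη : η ≠ 0)
    (C : Submodule F (Fin n → F))
    (hC : C = Submodule.span F (Set.range (Sum.elim
      (fun (a : Fin ((k - 1) / 2 + 1)) => fun i => α i ^ (a : ℕ))
      (fun (b : Fin ((k - 3) / 2 + 1)) => fun i => α i ^ (b : ℕ) * β i +
        if (b : ℕ) = ℓ then η * α i ^ ((k + 1) / 2) else 0)))) :
    ∀ (a : Fin n → F), Function.Injective a →
    ∀ (u : Fin n → F), (∀ i, u i ≠ 0) →
    ∀ (σ : Equiv.Perm (Fin n)) (w : Fin n → F), (∀ i, w i ≠ 0) →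
      {c : Fin n → F | ∃ p : F[X], p.degree < (k : WithBot ℕ) ∧
          c = fun i => u i * p.eval (a i)} ≠
        (fun c : Fin n → F => fun i => w i * c (σ i)) '' (C : Set (Fin n → F)) := by
  intro a ha u hu σ w hw heq
  have h2 : (2 : F) ≠ 0 := Ring.two_ne_zero hchar
  set a' : Fin n → F := fun i => a (σ.symm i)
  set v : Fin n → F := fun i => u (σ.symm i) / w (σ.symm i)
  have ha' : Function.Injective a' := ha.comp σ.symm.injective
  have hv : ∀ i, v i ≠ 0 := fun i => div_ne_zero (hu _) (hw _)
  have hmem : ∀ p : F[X], p.degree < (k : WithBot ℕ) → (fun i => v i * p.eval (a' i)) ∈ C := by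
    intro p hp
    obtain ⟨c, hc, h⟩ := heq.subset ⟨p, hp, rfl⟩
    have : c = fun i => v i * p.eval (a' i) := by
      funext i
      have := congrFun h (σ.symm i)
      simp only [Equiv.apply_symm_apply] at this
      simp only [v, a', div_mul_eq_mul_div]
      rw [eq_div_iff (hw _), ← this, mul_comm]
    rwa [← this]
  have hpoly : ∀ c ∈ C, ∃ p : F[X], p.natDegree < k ∧ ∀ i, c i = v i * p.eval (a' i) := by
    intro c hc
    obtain ⟨p, hp, h⟩ := heq.superset ⟨c, hc, rfl⟩
    refine ⟨p, natDegree_lt_of_degree_lt_of_pos hp hk.pos, fun i => ?_⟩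
    have := congrFun h (σ.symm i)
    simp only [Equiv.apply_symm_apply] at this
    simp only [v, a', div_mul_eq_mul_div]
    rw [eq_div_iff (hw _), ← this, mul_comm]
  obtain ⟨j, rfl⟩ := hk
  rw [show (2 * j + 1 - 1) / 2 = j by omega, show (2 * j + 1 - 3) / 2 + 1 = j by omega,
    show (2 * j + 1 + 1) / 2 = j + 1 by omega] at hC
  by_cases hj : 3 ≤ j
  · have hn : 2 * j + 5 ≤ n := by omega
    have hcast := Fin.castLE_injective hn
    refine false_of_GRS_le_curve_code h2 hsf hdeg (α := α ∘ Fin.castLE hn) (β := β ∘ Fin.castLE hn)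
      (a := a' ∘ Fin.castLE hn) (v := v ∘ Fin.castLE hn) (hdist.comp hcast) (fun i => hβ0 _)
      (fun i => hcurve _) (ha'.comp hcast) (fun i => hv _) hj (by simp) fun p hp => ?_
    have := hmem p hp
    rw [hC] at this
    obtain ⟨c, d, hc, hd, h⟩ := exists_polynomials_of_mem_span this
    exact ⟨c, d, hc, hd, fun i => h _⟩
  · obtain rfl : j = 2 := by omega
    have hn : 14 ≤ Fintype.card (Fin n) := by rw [Fintype.card_fin]; omega
    have hgen := fun s => hC ▸ Submodule.subset_span (R := F) (Set.mem_range_self s)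
    obtain ⟨p₀, d₀, h₀⟩ := hpoly _ (hgen (.inl 0))
    obtain ⟨p₁, d₁, h₁⟩ := hpoly _ (hgen (.inl 1))
    obtain ⟨p₂, d₂, h₂⟩ := hpoly _ (hgen (.inl 2))
    simp only [Sum.elim_inl, Fin.val_zero, Fin.val_one, Fin.val_two, pow_zero, pow_one]
      at h₀ h₁ h₂
    obtain rfl | rfl : ℓ = 0 ∨ ℓ = 1 := by omega
    · obtain ⟨r, dr, hr⟩ := hpoly _ (hgen (.inr 1))
      exact false_of_x_mul_y_mem_GRS h2 hsf hdeg hdist hcurve ha' hn (by omega) (by omega)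
        (by omega) (Nat.le_of_lt_succ dr) h₀ h₁ h₂ fun i => by simpa using hr i
    · obtain ⟨r, dr, hr⟩ := hpoly _ (hgen (.inr 0))
      exact false_of_y_mem_GRS h2 hsf hdeg hdist hcurve ha' hn (by omega) (by omega)
        (Nat.le_of_lt_succ dr) h₀ h₁ fun i => by simpa using hr i
end

section
/- Let q be a power of an odd prime, f ∈ 𝔽_q[X] square-free of degree 3, and let D consist of n pairwise distinct affine points P_i = (α_i, β_i) of y² = f(x) with β_i ≠ 0 for all i. Let k be odd with 4 ≤ k ≤ (n−4)/2 or (n+4)/2 ≤ k ≤ n−4, and let 0 ≤ ℓ ≤ (k−3)/2 and η ∈ 𝔽_q^*. Then the twisted elliptic curve code C(D, kO, ℓ, η) is not monomially equivalent to any elliptic curve code C_L(D', kO), where g ∈ 𝔽_q[X] is any square-free polynomial of degree 3 and D' is any set of n pairwise distinct affine points of the curve y² = g(x). -/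
open Polynomial

theorem Polynomial.sq_ne_comp_of_separable {F : Type*} [Field F] (h2 : (2 : F) ≠ 0) {f p q : F[X]}
    (hf : f.Separable) (hf3 : f.natDegree = 3) (hp : p.natDegree = 2) : q ^ 2 ≠ f.comp p := by
  intro h
  have hq : q.natDegree = 3 := by
    have := congrArg natDegree h
    rw [natDegree_pow, natDegree_comp, hf3, hp] at this
    omega
  have hp' : p.derivative ≠ 0 := by
    intro h0
    have h1 := congrArg (fun r => coeff r 1) h0
    have h3 : p.coeff 2 ≠ 0 := by
      rw [← hp]
      exact leadingCoeff_ne_zero.2 fun h => by simp [h] at hp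
    rw [coeff_derivative] at h1
    norm_num at h1
    exact h1.elim h3 h2
  have hcop : IsCoprime q (f.derivative.comp p) := by
    obtain ⟨a, b, hab⟩ := hf
    refine ⟨a.comp p * q, b.comp p, ?_⟩
    have := congrArg (fun r => r.comp p) hab
    simp only [add_comp, mul_comp, one_comp] at this
    rw [← this, ← h]
    ring
  have hdvd : q ∣ p.derivative := by
    refine hcop.dvd_of_dvd_mul_left ⟨2 * q.derivative, ?_⟩
    have := congrArg derivative h
    rw [derivative_comp, derivative_pow] at this
    rw [mul_comm, ← this]
    simp only [Nat.cast_ofNat, map_ofNat, Nat.add_one_sub_one, pow_one]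
    ring
  refine hp' (eq_zero_of_dvd_of_natDegree_lt hdvd ?_)
  exact (natDegree_derivative_lt (by omega)).trans (by omega)

open Module in
theorem card_add_finrank_le_of_triangular {F W I : Type*} [Field F] [AddCommGroup W] [Module F W]
    [FiniteDimensional F W] [LinearOrder I] (S : Finset I) (z : I → W →ₗ[F] F) (p : I → W)
    (Q P : Submodule F W) (hQP : Q ≤ P) (hp : ∀ r ∈ S, p r ∈ P)
    (hne : ∀ r ∈ S, z r (p r) ≠ 0) (hz : ∀ r ∈ S, ∀ r' ∈ S, r' < r → z r' (p r) = 0)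
    (hQ : ∀ r ∈ S, ∀ q ∈ Q, z r q = 0) : S.card + finrank F Q ≤ finrank F P := by
  classical
  induction S using Finset.induction_on_min generalizing P with
  | empty => simpa using Submodule.finrank_mono hQP
  | insert r₀ S hmin ih =>
    have hr₀ : r₀ ∉ S := fun h => lt_irrefl _ (hmin _ h)
    have key := ih (P ⊓ LinearMap.ker (z r₀))
      (le_inf hQP fun q hq => hQ r₀ (Finset.mem_insert_self _ _) q hq)
      (fun r hr => ⟨hp r (Finset.mem_insert_of_mem hr),
        hz r (Finset.mem_insert_of_mem hr) r₀ (Finset.mem_insert_self _ _) (hmin r hr)⟩)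
      (fun r hr => hne r (Finset.mem_insert_of_mem hr))
      (fun r hr r' hr' => hz r (Finset.mem_insert_of_mem hr) r' (Finset.mem_insert_of_mem hr'))
      (fun r hr => hQ r (Finset.mem_insert_of_mem hr))
    have hlt : P ⊓ LinearMap.ker (z r₀) < P := by
      refine lt_of_le_of_ne inf_le_left fun h => hne r₀ (Finset.mem_insert_self _ _) ?_
      have : p r₀ ∈ P ⊓ LinearMap.ker (z r₀) := h.ge (hp r₀ (Finset.mem_insert_self _ _))
      exact this.2
    have := Submodule.finrank_lt_finrank_of_lt hlt
    rw [Finset.card_insert_of_notMem hr₀]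
    omega

/-- Pairwise distinct affine points on a plane cubic `y² = c₃x³ + c₂x² + c₁x + c₀`. -/
structure CubicPoints (ι F : Type*) [Field F] where
  (x y : ι → F)
  (c₀ c₁ c₂ c₃ : F)
  lead_ne : c₃ ≠ 0
  curve : ∀ i, y i ^ 2 = c₃ * x i ^ 3 + c₂ * x i ^ 2 + c₁ * x i + c₀
  inj : ∀ i j, x i = x j → y i = y j → i = j

namespace CubicPoints

open Module Set

variable {ι F : Type*} [Field F] (D : CubicPoints ι F)

/-- The values at the points of the monomial `x^a` or `x^a y` with pole order `j` at infinity
(zero for the gap `j = 1`). -/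
def mono : ℕ → ι → F
  | 0 => 1
  | 1 => 0
  | 2 => D.x
  | 3 => D.y
  | (j + 4) => D.x * mono (j + 2)

theorem mono_add_two {j : ℕ} (hj : j ≠ 1) : D.mono (j + 2) = D.x * D.mono j := by
  match j with
  | 0 => simp [mono]
  | 1 => exact absurd rfl hj
  | (j + 2) => rw [mono]

theorem mono_even (a : ℕ) : D.mono (2 * a) = D.x ^ a := by
  induction a with
  | zero => simp [mono]
  | succ a ih => rw [mul_add, mul_one, D.mono_add_two (by omega), ih, pow_succ']

theorem mono_odd (a : ℕ) : D.mono (2 * a + 3) = D.x ^ a * D.y := by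
  induction a with
  | zero => simp [mono]
  | succ a ih =>
    rw [show 2 * (a + 1) + 3 = 2 * a + 3 + 2 by ring, D.mono_add_two (by omega), ih, pow_succ',
      mul_assoc]

theorem eq_even_or_odd (j : ℕ) : j = 1 ∨ (∃ a, j = 2 * a) ∨ ∃ a, j = 2 * a + 3 := by
  rcases Nat.even_or_odd' j with ⟨a, rfl | rfl⟩
  · exact Or.inr (Or.inl ⟨a, rfl⟩)
  · rcases a with _ | a
    · exact Or.inl rfl
    · exact Or.inr (Or.inr ⟨a, by ring⟩)

theorem y_mul_mono_even (a : ℕ) : D.y * D.mono (2 * a) = D.mono (2 * a + 3) := by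
  rw [mono_even, mono_odd, mul_comm]

theorem y_mul_mono_odd (a : ℕ) : D.y * D.mono (2 * a + 3) =
    D.c₃ • D.mono (2 * a + 6) + D.c₂ • D.mono (2 * a + 4) + D.c₁ • D.mono (2 * a + 2)
      + D.c₀ • D.mono (2 * a) := by
  rw [show 2 * a + 6 = 2 * (a + 3) by ring, show 2 * a + 4 = 2 * (a + 2) by ring,
    show 2 * a + 2 = 2 * (a + 1) by ring, mono_odd]
  simp only [mono_even]
  ext i
  have := D.curve i
  simp only [Pi.mul_apply, Pi.pow_apply, Pi.add_apply, Pi.smul_apply, smul_eq_mul]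
  linear_combination D.x i ^ a * this

/-- The span of the monomials with pole order less than `N`. -/
def below (N : ℕ) : Submodule F (ι → F) := Submodule.span F (D.mono '' Iio N)

theorem mono_mem_below {j N : ℕ} (h : j < N) : D.mono j ∈ D.below N :=
  Submodule.subset_span ⟨j, h, rfl⟩

theorem below_mono {M N : ℕ} (h : M ≤ N) : D.below M ≤ D.below N :=
  Submodule.span_mono (image_mono (Iio_subset_Iio h))

theorem x_mul_mono_mem (j : ℕ) : D.x * D.mono j ∈ D.below (j + 3) := by
  by_cases hj : j = 1
  · subst hj; simp [mono]
  · rw [← D.mono_add_two hj]; exact D.mono_mem_below (by omega)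

/-- The leading term of `y` times a monomial. -/
theorem exists_y_mul_mono {j : ℕ} (hj : j ≠ 1) :
    ∃ κ : F, κ ≠ 0 ∧ ∃ w ∈ D.below (j + 3), D.y * D.mono j = κ • D.mono (j + 3) + w := by
  rcases eq_even_or_odd j with rfl | ⟨a, rfl⟩ | ⟨a, rfl⟩
  · exact absurd rfl hj
  · exact ⟨1, one_ne_zero, 0, zero_mem _, by rw [y_mul_mono_even]; simp⟩
  · refine ⟨D.c₃, D.lead_ne, D.c₂ • D.mono (2 * a + 4) + D.c₁ • D.mono (2 * a + 2)
      + D.c₀ • D.mono (2 * a), ?_, ?_⟩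
    · exact add_mem (add_mem (Submodule.smul_mem _ _ (D.mono_mem_below (by omega)))
        (Submodule.smul_mem _ _ (D.mono_mem_below (by omega))))
        (Submodule.smul_mem _ _ (D.mono_mem_below (by omega)))
    · rw [y_mul_mono_odd]; simp only [add_assoc]

theorem y_mul_mono_mem (j : ℕ) : D.y * D.mono j ∈ D.below (j + 4) := by
  by_cases hj : j = 1
  · subst hj; simp [mono]
  · obtain ⟨κ, -, w, hw, h⟩ := D.exists_y_mul_mono hj
    rw [h]
    exact add_mem (Submodule.smul_mem _ _ (D.mono_mem_below (by omega)))
      (D.below_mono (by omega) hw)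

theorem x_mul_mem {N : ℕ} {w : ι → F} (hw : w ∈ D.below N) : D.x * w ∈ D.below (N + 2) := by
  induction hw using Submodule.span_induction with
  | mem w h =>
    obtain ⟨j, hj, rfl⟩ := h
    have : j < N := hj
    exact D.below_mono (by omega) (D.x_mul_mono_mem j)
  | zero => simp
  | add u v _ _ hu hv => rw [mul_add]; exact add_mem hu hv
  | smul a u _ hu => rw [mul_smul_comm]; exact Submodule.smul_mem _ _ hu

theorem y_mul_mem {N : ℕ} {w : ι → F} (hw : w ∈ D.below N) : D.y * w ∈ D.below (N + 3) := by
  induction hw using Submodule.span_induction with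
  | mem w h =>
    obtain ⟨j, hj, rfl⟩ := h
    have : j < N := hj
    exact D.below_mono (by omega) (D.y_mul_mono_mem j)
  | zero => simp
  | add u v _ _ hu hv => rw [mul_add]; exact add_mem hu hv
  | smul a u _ hu => rw [mul_smul_comm]; exact Submodule.smul_mem _ _ hu

theorem below_succ_of_mem {N : ℕ} (h : D.mono N ∈ D.below N) : D.below (N + 1) = D.below N := by
  refine le_antisymm (Submodule.span_le.2 ?_) (D.below_mono (by omega))
  rintro _ ⟨j, hj, rfl⟩
  rcases Nat.lt_succ_iff_lt_or_eq.1 hj with hj | rfl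
  · exact D.mono_mem_below hj
  · exact h

/-- `r` is the pole order of a nonzero function vanishing at all the points. -/
def IsLead (r : ℕ) : Prop := r ≠ 1 ∧ D.mono r ∈ D.below r

theorem below_succ_of_isLead {N : ℕ} (h : D.IsLead N) : D.below (N + 1) = D.below N :=
  D.below_succ_of_mem h.2

variable {D} in
theorem IsLead.add_two {r : ℕ} (h : D.IsLead r) : D.IsLead (r + 2) :=
  ⟨by omega, by rw [D.mono_add_two h.1]; exact D.x_mul_mem h.2⟩

variable {D} in
theorem IsLead.add_three {r : ℕ} (h : D.IsLead r) : D.IsLead (r + 3) := by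
  refine ⟨by omega, ?_⟩
  obtain ⟨κ, hκ, w, hw, e⟩ := D.exists_y_mul_mono h.1
  have h1 := D.y_mul_mem h.2
  rw [e] at h1
  have := (Submodule.add_mem_iff_left _ hw).1 h1
  exact (Submodule.smul_mem_iff _ hκ).1 this

variable {D} in
theorem IsLead.of_add_two_le {r l : ℕ} (h : D.IsLead r) (hl : r + 2 ≤ l) : D.IsLead l := by
  obtain ⟨t, rfl⟩ := Nat.exists_eq_add_of_le hl
  induction t using Nat.twoStepInduction with
  | zero => exact h.add_two
  | one => exact h.add_three
  | more t ih _ => exact (ih (by omega)).add_two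

theorem exists_below_vanish [DecidableEq ι] (i : ι) (A : Finset ι) (hi : i ∉ A) :
    ∃ N, ∃ w ∈ D.below N, w i ≠ 0 ∧ ∀ j ∈ A, w j = 0 := by
  induction A using Finset.induction_on with
  | empty => exact ⟨1, 1, D.mono_mem_below (j := 0) (by omega), by simp, by simp⟩
  | insert j A hj ih =>
    have hij : i ≠ j := fun h => hi (h ▸ Finset.mem_insert_self _ _)
    obtain ⟨N, w, hw, hwi, hwA⟩ := ih fun h => hi (Finset.mem_insert_of_mem h)
    by_cases hx : D.x i = D.x j
    · refine ⟨N + 3, D.y * w - D.y j • w, sub_mem (D.y_mul_mem hw)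
        (Submodule.smul_mem _ _ (D.below_mono (by omega) hw)), ?_, ?_⟩
      · simp only [Pi.sub_apply, Pi.mul_apply, Pi.smul_apply, smul_eq_mul, ← sub_mul]
        exact mul_ne_zero (sub_ne_zero.2 fun hy => hij (D.inj i j hx hy)) hwi
      · intro l hl
        simp only [Pi.sub_apply, Pi.mul_apply, Pi.smul_apply, smul_eq_mul, ← sub_mul]
        rcases Finset.mem_insert.1 hl with rfl | hl
        · simp
        · simp [hwA l hl]
    · refine ⟨N + 2, D.x * w - D.x j • w, sub_mem (D.x_mul_mem hw)
        (Submodule.smul_mem _ _ (D.below_mono (by omega) hw)), ?_, ?_⟩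
      · simp only [Pi.sub_apply, Pi.mul_apply, Pi.smul_apply, smul_eq_mul, ← sub_mul]
        exact mul_ne_zero (sub_ne_zero.2 hx) hwi
      · intro l hl
        simp only [Pi.sub_apply, Pi.mul_apply, Pi.smul_apply, smul_eq_mul, ← sub_mul]
        rcases Finset.mem_insert.1 hl with rfl | hl
        · simp
        · simp [hwA l hl]

variable [Fintype ι]

theorem exists_mem_below (v : ι → F) : ∃ N, v ∈ D.below N := by
  classical
  have h1 : ∀ i, ∃ N, Pi.single i (1 : F) ∈ D.below N := by
    intro i
    obtain ⟨N, w, hw, hwi, hwA⟩ := D.exists_below_vanish i (Finset.univ.erase i) (by simp)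
    refine ⟨N, ?_⟩
    have : Pi.single i (1 : F) = (w i)⁻¹ • w := by
      ext j
      by_cases hj : j = i
      · subst hj; simp [hwi]
      · simp [hj, hwA j (by simp [hj])]
    rw [this]
    exact Submodule.smul_mem _ _ hw
  choose N hN using h1
  refine ⟨Finset.univ.sup N, ?_⟩
  rw [← Finset.univ_sum_single v]
  refine sum_mem fun i _ => ?_
  rw [show (Pi.single i (v i) : ι → F) = v i • Pi.single i (1 : F) by
    rw [← Pi.single_smul]; simp]
  exact Submodule.smul_mem _ _ (D.below_mono (Finset.le_sup (Finset.mem_univ i)) (hN i))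

theorem below_eq_top_of_forall {M : ℕ} (h : ∀ l, M ≤ l → D.IsLead l) : D.below M = ⊤ := by
  have h1 : ∀ t, D.below (M + t) = D.below M := by
    intro t
    induction t with
    | zero => rfl
    | succ t ih => rw [← add_assoc, D.below_succ_of_isLead (h _ (by omega)), ih]
  refine eq_top_iff.2 fun v _ => ?_
  obtain ⟨N, hN⟩ := D.exists_mem_below v
  rw [← h1 N]
  exact D.below_mono (by omega) hN

theorem finrank_span_mono_le (A : Finset ℕ) :
    finrank F (Submodule.span F (D.mono '' A)) ≤ (A.erase 1).card := by
  classical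
  have : Submodule.span F (D.mono '' A) ≤
      Submodule.span F (((A.erase 1).image D.mono : Finset (ι → F)) : Set (ι → F)) := by
    refine Submodule.span_le.2 ?_
    rintro _ ⟨j, hj, rfl⟩
    by_cases h1 : j = 1
    · subst h1; simp [mono]
    · refine Submodule.subset_span ?_
      rw [Finset.coe_image]
      exact ⟨j, by simpa [h1] using hj, rfl⟩
  exact (Submodule.finrank_mono this).trans
    ((finrank_span_finset_le_card _).trans Finset.card_image_le)

theorem card_le_of_isLead {r : ℕ} (h : D.IsLead r) : Fintype.card ι ≤ r := by
  have htop := D.below_eq_top_of_forall fun l hl => h.of_add_two_le hl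
  have hle : (⊤ : Submodule F (ι → F)) ≤
      Submodule.span F (D.mono '' ((Finset.range (r + 2)).erase r : Finset ℕ)) := by
    have hlow : D.below r ≤
        Submodule.span F (D.mono '' ((Finset.range (r + 2)).erase r : Finset ℕ)) := by
      refine Submodule.span_mono (image_mono fun j hj => ?_)
      have : j < r := hj
      simp; omega
    rw [← htop]
    refine Submodule.span_le.2 ?_
    rintro _ ⟨j, hj, rfl⟩
    have hj' : j < r + 2 := hj
    by_cases hjr : j = r
    · subst hjr; exact hlow h.2
    · exact Submodule.subset_span ⟨j, by simp; omega, rfl⟩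
  have h1 := (Submodule.finrank_mono hle).trans (D.finrank_span_mono_le _)
  rw [finrank_top, finrank_fintype_fun_eq_card] at h1
  have h2 := h.1
  have h3 : 1 ∈ (Finset.range (r + 2)).erase r := by simp; omega
  rw [Finset.card_erase_of_mem h3, Finset.card_erase_of_mem (by simp), Finset.card_range] at h1
  omega

theorem card_lt_of_isLead_succ {r : ℕ} (h : D.IsLead r) (h' : D.IsLead (r + 1)) :
    Fintype.card ι < r := by
  have htop : D.below r = ⊤ := D.below_eq_top_of_forall fun l hl => by
    rcases Nat.lt_or_ge l (r + 2) with h1 | h1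
    · rcases Nat.lt_or_ge l (r + 1) with h2 | h2
      · rwa [show l = r by omega]
      · rwa [show l = r + 1 by omega]
    · exact h.of_add_two_le h1
  have h1 := D.finrank_span_mono_le (Finset.range r)
  rw [Finset.coe_range, show Submodule.span F (D.mono '' Iio r) = ⊤ from htop, finrank_top,
    finrank_fintype_fun_eq_card] at h1
  have := h.1
  have := h'.1
  rw [Finset.card_erase_of_mem (by simp; omega), Finset.card_range] at h1
  omega

theorem le_finrank_below {N : ℕ} (h : ∀ l < N, ¬ D.IsLead l) : N ≤ finrank F (D.below N) + 1 := by
  induction N with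
  | zero => omega
  | succ N ih =>
    have ih' := ih fun l hl => h l (by omega)
    by_cases h1 : N = 1
    · subst h1
      have h0 : D.mono 0 ∉ D.below 0 := fun h0 => h 0 (by omega) ⟨by omega, h0⟩
      have hlt : D.below 0 < D.below 2 := lt_of_le_of_ne (D.below_mono (by omega)) fun e =>
        h0 (e ▸ D.mono_mem_below (by omega))
      have := Submodule.finrank_lt_finrank_of_lt hlt
      change 2 ≤ finrank F (D.below 2) + 1
      omega
    · have hN : D.mono N ∉ D.below N := fun h0 => h N (by omega) ⟨h1, h0⟩
      have hlt : D.below N < D.below (N + 1) := lt_of_le_of_ne (D.below_mono (by omega)) fun e =>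
        hN (e ▸ D.mono_mem_below (by omega))
      have := Submodule.finrank_lt_finrank_of_lt hlt
      omega

theorem not_isLead_of_lt {r : ℕ} (h : r < Fintype.card ι) : ¬ D.IsLead r :=
  fun hr => absurd (D.card_le_of_isLead hr) (by omega)

theorem below_card_succ (h : ¬ D.IsLead (Fintype.card ι)) :
    D.below (Fintype.card ι + 1) = ⊤ := by
  apply Submodule.eq_top_of_finrank_eq
  have := D.le_finrank_below (N := Fintype.card ι + 1) fun l hl => by
    rcases Nat.lt_or_ge l (Fintype.card ι) with h1 | h1
    · exact D.not_isLead_of_lt h1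
    · rwa [show l = Fintype.card ι by omega]
  have h2 := Submodule.finrank_le (D.below (Fintype.card ι + 1))
  rw [finrank_fintype_fun_eq_card] at h2 ⊢
  omega

theorem isLead_of_card_lt (h : ¬ D.IsLead (Fintype.card ι)) {r : ℕ} (hr : Fintype.card ι < r)
    (h1 : r ≠ 1) : D.IsLead r :=
  ⟨h1, D.below_mono (show Fintype.card ι + 1 ≤ r by omega)
    (by rw [D.below_card_succ h]; trivial)⟩

theorem below_card_add_two : D.below (Fintype.card ι + 2) = ⊤ := by
  by_cases h : D.IsLead (Fintype.card ι)
  · exact D.below_eq_top_of_forall fun l hl => h.of_add_two_le hl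
  · exact top_le_iff.1 ((D.below_card_succ h).symm.le.trans (D.below_mono (by omega)))

theorem isLead_of_card_add_two_le {r : ℕ} (hr : Fintype.card ι + 2 ≤ r) : D.IsLead r :=
  ⟨by omega, D.below_mono hr (by rw [D.below_card_add_two]; trivial)⟩

/-- The vectors orthogonal to all functions with pole order less than `j`. -/
def dualFil (j : ℕ) : Submodule F (ι → F) where
  carrier := {u | ∀ l < j, u ⬝ᵥ D.mono l = 0}
  add_mem' := fun hu hv l hl => by rw [add_dotProduct, hu l hl, hv l hl, add_zero]
  zero_mem' := fun l _ => zero_dotProduct _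
  smul_mem' := fun a u hu l hl => by rw [smul_dotProduct, hu l hl, smul_zero]

/-- `v` is the least pole order of a monomial not orthogonal to `u`. -/
def HasVal (u : ι → F) (v : ℕ) : Prop := u ∈ D.dualFil v ∧ u ⬝ᵥ D.mono v ≠ 0

theorem dualFil_anti {a b : ℕ} (h : a ≤ b) : D.dualFil b ≤ D.dualFil a :=
  fun _ hu l hl => hu l (by omega)

theorem dotProduct_mono_one (u : ι → F) : u ⬝ᵥ D.mono 1 = 0 := dotProduct_zero u

variable {D} in
theorem HasVal.ne_one {u : ι → F} {v : ℕ} (h : D.HasVal u v) : v ≠ 1 := by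
  rintro rfl; exact h.2 (D.dotProduct_mono_one u)

theorem dotProduct_below {u w : ι → F} {j : ℕ} (hu : u ∈ D.dualFil j) (hw : w ∈ D.below j) :
    u ⬝ᵥ w = 0 := by
  induction hw using Submodule.span_induction with
  | mem w h => obtain ⟨l, hl, rfl⟩ := h; exact hu l hl
  | zero => simp
  | add a b _ _ ha hb => rw [dotProduct_add, ha, hb, add_zero]
  | smul a b _ hb => rw [dotProduct_smul, hb, smul_zero]

theorem mul_dotProduct_eq (a u v : ι → F) : (a * u) ⬝ᵥ v = u ⬝ᵥ (a * v) := by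
  simp only [dotProduct, Pi.mul_apply]
  exact Finset.sum_congr rfl fun i _ => by ring

theorem x_mul_mem_dualFil {u : ι → F} {j : ℕ} (hu : u ∈ D.dualFil j) :
    D.x * u ∈ D.dualFil (j - 2) := by
  intro l hl
  rw [mul_dotProduct_eq]
  exact D.dotProduct_below hu (D.below_mono (by omega) (D.x_mul_mono_mem l))

theorem y_mul_mem_dualFil {u : ι → F} {j : ℕ} (hu : u ∈ D.dualFil j) :
    D.y * u ∈ D.dualFil (j - 3) := by
  intro l hl
  rw [mul_dotProduct_eq]
  exact D.dotProduct_below hu (D.below_mono (by omega) (D.y_mul_mono_mem l))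

theorem x_mul_dotProduct {u : ι → F} {j : ℕ} (hj : j ≠ 1) :
    (D.x * u) ⬝ᵥ D.mono j = u ⬝ᵥ D.mono (j + 2) := by
  rw [mul_dotProduct_eq, D.mono_add_two hj]

variable {D} in
theorem HasVal.x_mul {u : ι → F} {j : ℕ} (hu : D.HasVal u (j + 2)) (hj : j ≠ 1) :
    D.HasVal (D.x * u) j :=
  ⟨D.x_mul_mem_dualFil hu.1, by rw [D.x_mul_dotProduct hj]; exact hu.2⟩

variable {D} in
theorem HasVal.dotProduct_y_mul {u : ι → F} {j : ℕ} (hu : D.HasVal u (j + 3)) (hj : j ≠ 1) :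
    u ⬝ᵥ (D.y * D.mono j) ≠ 0 := by
  obtain ⟨κ, hκ, w, hw, e⟩ := D.exists_y_mul_mono hj
  rw [e, dotProduct_add, D.dotProduct_below hu.1 hw, add_zero, dotProduct_smul]
  exact smul_ne_zero hκ hu.2

variable {D} in
theorem HasVal.y_mul {u : ι → F} {j : ℕ} (hu : D.HasVal u (j + 3)) (hj : j ≠ 1) :
    D.HasVal (D.y * u) j :=
  ⟨D.y_mul_mem_dualFil hu.1, by rw [mul_dotProduct_eq]; exact hu.dotProduct_y_mul hj⟩

theorem exists_hasVal {v : ℕ} (h : ¬ D.IsLead v) (hv : v ≠ 1) : ∃ u, D.HasVal u v := by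
  have h1 : D.mono v ∉ D.below v := fun h1 => h ⟨hv, h1⟩
  obtain ⟨g, hg, hg'⟩ := Submodule.exists_le_ker_of_notMem h1
  classical
  have key : ∀ w, (fun i => g (Pi.single i 1)) ⬝ᵥ w = g w := by
    intro w
    conv_rhs => rw [← Finset.univ_sum_single w]
    rw [map_sum, dotProduct]
    refine Finset.sum_congr rfl fun i _ => ?_
    rw [show (Pi.single i (w i) : ι → F) = w i • Pi.single i (1 : F) by
      rw [← Pi.single_smul]; simp, map_smul, smul_eq_mul, mul_comm]
  refine ⟨fun i => g (Pi.single i 1), fun l hl => ?_, ?_⟩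
  · rw [key]; exact hg' (D.mono_mem_below hl)
  · rw [key]; exact hg

theorem exists_dotProduct_eq {N : ℕ} (h : ∀ l < N, ¬ D.IsLead l) (t : ℕ → F) :
    ∃ u : ι → F, ∀ l < N, l ≠ 1 → u ⬝ᵥ D.mono l = t l := by
  induction N with
  | zero => exact ⟨0, by simp⟩
  | succ N ih =>
    obtain ⟨u, hu⟩ := ih fun l hl => h l (by omega)
    by_cases hN : N = 1
    · exact ⟨u, fun l hl h1 => hu l (by omega) h1⟩
    · obtain ⟨v, hv, hv'⟩ := D.exists_hasVal (h N (by omega)) hN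
      refine ⟨u + ((t N - u ⬝ᵥ D.mono N) / (v ⬝ᵥ D.mono N)) • v, fun l hl h1 => ?_⟩
      rw [add_dotProduct, smul_dotProduct, smul_eq_mul]
      rcases Nat.lt_succ_iff_lt_or_eq.1 hl with h2 | rfl
      · rw [hu l h2 h1, hv l h2, mul_zero, add_zero]
      · rw [div_mul_cancel₀ _ hv']; ring

variable {D} in
theorem HasVal.exists_sub_mem {u v : ι → F} {j : ℕ} (hu : D.HasVal u j) (hv : v ∈ D.dualFil j) :
    ∃ c : F, v - c • u ∈ D.dualFil (j + 1) := by
  refine ⟨v ⬝ᵥ D.mono j / u ⬝ᵥ D.mono j, fun l hl => ?_⟩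
  rw [sub_dotProduct, smul_dotProduct, smul_eq_mul]
  rcases Nat.lt_succ_iff_lt_or_eq.1 hl with h | rfl
  · rw [hv l h, hu.1 l h]; simp
  · rw [div_mul_cancel₀ _ hu.2, sub_self]

theorem dualFil_eq_bot {j : ℕ} (h : D.below j = ⊤) : D.dualFil j = ⊥ := by
  refine (Submodule.eq_bot_iff _).2 fun u hu => ?_
  exact dotProduct_eq_zero u fun w => D.dotProduct_below hu (by rw [h]; trivial)

theorem mono_mul_mem_dualFil {u : ι → F} {i j : ℕ} (hu : u ∈ D.dualFil j) :
    D.mono i * u ∈ D.dualFil (j - i) := by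
  induction i using Nat.strong_induction_on generalizing u j with
  | _ i ih =>
    match i with
    | 0 => simpa [mono] using hu
    | 1 => simp [mono]
    | 2 => exact D.x_mul_mem_dualFil hu
    | 3 => exact D.y_mul_mem_dualFil hu
    | (i + 4) =>
      rw [mono, mul_comm D.x, mul_assoc]
      exact D.dualFil_anti (by omega) (ih (i + 2) (by omega) (D.x_mul_mem_dualFil hu))

variable {D} in
theorem HasVal.mono_mul {u : ι → F} {i j : ℕ} (hu : D.HasVal u (j + i)) (hi : i ≠ 1)
    (hj : j ≠ 1) : D.HasVal (D.mono i * u) j := by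
  induction i using Nat.strong_induction_on generalizing u j with
  | _ i ih =>
    match i with
    | 0 => simpa [mono] using hu
    | 1 => exact absurd rfl hi
    | 2 => exact hu.x_mul hj
    | 3 => exact hu.y_mul hj
    | (i + 4) =>
      rw [mono, mul_comm D.x, mul_assoc]
      exact ih (i + 2) (by omega) (HasVal.x_mul (j := j + (i + 2)) hu (by omega)) (by omega) hj

theorem dotProduct_mono_mul {u : ι → F} {i j l : ℕ} (hu : u ∈ D.dualFil l) (h : i + j < l) :
    u ⬝ᵥ (D.mono i * D.mono j) = 0 := by
  rw [← mul_dotProduct_eq]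
  exact D.mono_mul_mem_dualFil hu j (by omega)

variable {D} in
theorem HasVal.dotProduct_mono_mul {u : ι → F} {i j : ℕ} (hu : D.HasVal u (i + j)) (hi : i ≠ 1)
    (hj : j ≠ 1) : u ⬝ᵥ (D.mono i * D.mono j) ≠ 0 := by
  rw [← mul_dotProduct_eq]
  exact (HasVal.mono_mul (j := j) (by rwa [add_comm]) hi hj).2

/-- The divided difference `(f(x) - f(x')) / (x - x')` of the cubic. -/
def slope (i j : ι) : F :=
  D.c₃ * (D.x i ^ 2 + D.x i * D.x j + D.x j ^ 2) + D.c₂ * (D.x i + D.x j) + D.c₁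

/-- The kernel `(e(P) - e(Q)) (y(P) + y(Q)) / (x(P) - x(Q))`, where `e` is the monomial of pole
order `r`. -/
def kernel : ℕ → ι → ι → F
  | 0 => fun _ _ => 0
  | 1 => fun _ _ => 0
  | 2 => fun i j => D.y i + D.y j
  | 3 => fun i j => D.slope i j
  | (r + 4) => fun i j => D.x i * kernel (r + 2) i j + D.mono (r + 2) j * (D.y i + D.y j)

omit [Fintype ι] in
theorem kernel_add_two {r : ℕ} (hr : r ≠ 1) (i j : ι) : D.kernel (r + 2) i j =
    D.x i * D.kernel r i j + D.mono r j * (D.y i + D.y j) := by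
  match r with
  | 0 => simp [kernel, mono]
  | 1 => exact absurd rfl hr
  | (r + 2) => rw [kernel]

omit [Fintype ι] in
theorem y_sub_mul_y_add (i j : ι) :
    (D.y i - D.y j) * (D.y i + D.y j) = (D.x i - D.x j) * D.slope i j := by
  rw [slope]; linear_combination D.curve i - D.curve j

omit [Fintype ι] in
theorem x_sub_mul_kernel (r : ℕ) (i j : ι) : (D.x i - D.x j) * D.kernel r i j =
    (D.mono r i - D.mono r j) * (D.y i + D.y j) := by
  induction r using Nat.strong_induction_on with
  | _ r ih =>
    match r with
    | 0 => simp [kernel, mono]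
    | 1 => simp [kernel, mono]
    | 2 => simp [kernel, mono]
    | 3 => simp only [kernel, mono]; rw [y_sub_mul_y_add]
    | (r + 4) =>
      simp only [kernel, mono, Pi.mul_apply]
      linear_combination D.x i * ih (r + 2) (by omega)

omit [Fintype ι] in
theorem y_sub_mul_kernel (r : ℕ) (i j : ι) : (D.y i - D.y j) * D.kernel r i j =
    (D.mono r i - D.mono r j) * D.slope i j := by
  induction r using Nat.strong_induction_on with
  | _ r ih =>
    match r with
    | 0 => simp [kernel, mono]
    | 1 => simp [kernel, mono]
    | 2 => simp only [kernel, mono]; rw [y_sub_mul_y_add]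
    | 3 => simp [kernel, mono]
    | (r + 4) =>
      simp only [kernel, mono, Pi.mul_apply]
      linear_combination D.x i * ih (r + 2) (by omega) + D.mono (r + 2) j * D.y_sub_mul_y_add i j

/-- The bilinear form of a kernel. -/
def form (M : ι → ι → F) (u v : ι → F) : F := ∑ i, ∑ j, u i * v j * M i j

omit D in
theorem form_add (M M' : ι → ι → F) (u v : ι → F) :
    form (fun i j => M i j + M' i j) u v = form M u v + form M' u v := by
  simp only [form, mul_add, Finset.sum_add_distrib]

omit D in
theorem form_mul (a b u v : ι → F) : form (fun i j => a i * b j) u v = (u ⬝ᵥ a) * (v ⬝ᵥ b) := by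
  simp only [form, dotProduct, Finset.sum_mul_sum]
  exact Finset.sum_congr rfl fun i _ => Finset.sum_congr rfl fun j _ => by ring

omit D in
theorem form_const_mul (c : F) (M : ι → ι → F) (u v : ι → F) :
    form (fun i j => c * M i j) u v = c * form M u v := by
  simp only [form, Finset.mul_sum]
  exact Finset.sum_congr rfl fun i _ => Finset.sum_congr rfl fun j _ => by ring

theorem form_kernel_add_two {r : ℕ} (hr : r ≠ 1) (u v : ι → F) :
    form (D.kernel (r + 2)) u v = form (D.kernel r) (D.x * u) v
      + (u ⬝ᵥ D.mono 3) * (v ⬝ᵥ D.mono r) + (u ⬝ᵥ D.mono 0) * (v ⬝ᵥ (D.y * D.mono r)) := by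
  rw [← form_mul, ← form_mul]
  simp only [form, ← Finset.sum_add_distrib]
  refine Finset.sum_congr rfl fun i _ => Finset.sum_congr rfl fun j _ => ?_
  rw [D.kernel_add_two hr]
  simp only [mono, Pi.mul_apply, Pi.one_apply]
  ring

theorem form_slope (u v : ι → F) : form (D.kernel 3) u v =
    D.c₃ * ((u ⬝ᵥ D.mono 4) * (v ⬝ᵥ D.mono 0) + (u ⬝ᵥ D.mono 2) * (v ⬝ᵥ D.mono 2)
      + (u ⬝ᵥ D.mono 0) * (v ⬝ᵥ D.mono 4))
    + D.c₂ * ((u ⬝ᵥ D.mono 2) * (v ⬝ᵥ D.mono 0) + (u ⬝ᵥ D.mono 0) * (v ⬝ᵥ D.mono 2))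
    + D.c₁ * ((u ⬝ᵥ D.mono 0) * (v ⬝ᵥ D.mono 0)) := by
  simp only [← form_mul, ← form_add, ← form_const_mul]
  simp only [form]
  refine Finset.sum_congr rfl fun i _ => Finset.sum_congr rfl fun j _ => ?_
  simp only [kernel, slope, mono, Pi.mul_apply, Pi.one_apply]
  ring

theorem form_kernel_eq_zero {r a b : ℕ} {u v : ι → F} (hu : u ∈ D.dualFil a)
    (hv : v ∈ D.dualFil b) (h : r + 1 < a + b) : form (D.kernel r) u v = 0 := by
  induction r using Nat.strong_induction_on generalizing u v a b with
  | _ r ih =>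
    by_cases h0 : r = 0
    · subst h0; simp [form, kernel]
    by_cases h1 : r = 1
    · subst h1; simp [form, kernel]
    by_cases h3 : r = 3
    · subst h3
      have key : ∀ i j, i + j ≤ 4 → (u ⬝ᵥ D.mono i) * (v ⬝ᵥ D.mono j) = 0 := by
        intro i j hij
        rcases Nat.lt_or_ge i a with hi | hi
        · rw [hu i hi, zero_mul]
        · rw [hv j (by omega), mul_zero]
      rw [form_slope, key 4 0 (by omega), key 2 2 (by omega), key 0 4 (by omega),
        key 2 0 (by omega), key 0 2 (by omega), key 0 0 (by omega)]
      simp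
    obtain ⟨r, rfl⟩ : ∃ s, r = s + 2 := ⟨r - 2, by omega⟩
    have h1' : r ≠ 1 := by omega
    rw [D.form_kernel_add_two h1', ih r (by omega) (D.x_mul_mem_dualFil hu) hv (by omega)]
    have e1 : (u ⬝ᵥ D.mono 3) * (v ⬝ᵥ D.mono r) = 0 := by
      rcases Nat.lt_or_ge 3 a with ha | ha
      · rw [hu 3 ha, zero_mul]
      · rw [hv r (by omega), mul_zero]
    have e2 : (u ⬝ᵥ D.mono 0) * (v ⬝ᵥ (D.y * D.mono r)) = 0 := by
      rcases Nat.lt_or_ge 0 a with ha | ha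
      · rw [hu 0 ha, zero_mul]
      · rw [D.dotProduct_below hv (D.below_mono (by omega) (D.y_mul_mono_mem r)), mul_zero]
    rw [e1, e2]; simp

theorem form_kernel_ne_zero {r a b : ℕ} {u v : ι → F} (hr : r ≠ 1) (hu : D.HasVal u a)
    (hv : D.HasVal v b) (h : a + b = r + 1) : form (D.kernel r) u v ≠ 0 := by
  induction r using Nat.strong_induction_on generalizing u v a b with
  | _ r ih =>
    have ha1 := hu.ne_one
    have hb1 := hv.ne_one
    by_cases h0 : r = 0
    · omega
    by_cases h3 : r = 3
    · subst h3
      have key : ∀ i j, i < a ∨ j < b → (u ⬝ᵥ D.mono i) * (v ⬝ᵥ D.mono j) = 0 := by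
        rintro i j (hi | hj)
        · rw [hu.1 i hi, zero_mul]
        · rw [hv.1 j hj, mul_zero]
      rw [form_slope, key 2 0 (by omega), key 0 2 (by omega), key 0 0 (by omega)]
      have hne : (u ⬝ᵥ D.mono a) * (v ⬝ᵥ D.mono b) ≠ 0 := mul_ne_zero hu.2 hv.2
      obtain ⟨rfl, rfl⟩ | ⟨rfl, rfl⟩ | ⟨rfl, rfl⟩ :
          (a = 0 ∧ b = 4) ∨ (a = 2 ∧ b = 2) ∨ (a = 4 ∧ b = 0) := by omega
      · rw [key 4 0 (by omega), key 2 2 (by omega)]; simpa using ⟨D.lead_ne, mul_ne_zero_iff.1 hne⟩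
      · rw [key 4 0 (by omega), key 0 4 (by omega)]; simpa using ⟨D.lead_ne, mul_ne_zero_iff.1 hne⟩
      · rw [key 2 2 (by omega), key 0 4 (by omega)]; simpa using ⟨D.lead_ne, mul_ne_zero_iff.1 hne⟩
    obtain ⟨r, rfl⟩ : ∃ s, r = s + 2 := ⟨r - 2, by omega⟩
    have hr1 : r ≠ 1 := by omega
    rw [D.form_kernel_add_two hr1]
    rcases Nat.lt_or_ge 3 a with ha | ha
    · obtain ⟨a, rfl⟩ : ∃ s, a = s + 2 := ⟨a - 2, by omega⟩
      rw [hu.1 3 ha, hu.1 0 (by omega)]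
      simpa using ih r (by omega) hr1 (hu.x_mul (by omega)) hv (by omega)
    · obtain rfl | rfl | rfl : a = 0 ∨ a = 2 ∨ a = 3 := by omega
      · obtain rfl : b = r + 3 := by omega
        rw [D.form_kernel_eq_zero (D.x_mul_mem_dualFil hu.1) hv.1 (by omega), hv.1 r (by omega)]
        simpa using ⟨hu.2, hv.dotProduct_y_mul hr1⟩
      · obtain rfl : b = r + 1 := by omega
        rw [hv.1 r (by omega), hu.1 0 (by omega)]
        simpa using ih r (by omega) hr1 (hu.x_mul (j := 0) (by omega)) hv (by omega)
      · obtain rfl : b = r := by omega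
        have hx : D.x * u ∈ D.dualFil 2 := by
          intro l hl
          obtain rfl | rfl : l = 0 ∨ l = 1 := by omega
          · rw [D.x_mul_dotProduct (by omega)]; exact hu.1 2 (by omega)
          · exact D.dotProduct_mono_one _
        rw [D.form_kernel_eq_zero hx hv.1 (by omega), hu.1 0 (by omega)]
        simpa using ⟨hu.2, hv.2⟩

/-- Kernels of linear combinations of monomials of small pole order. -/
theorem exists_kernel_of_mem_below {r : ℕ} {w : ι → F} (hw : w ∈ D.below r) :
    ∃ M : ι → ι → F,
      (∀ i j, (D.x i - D.x j) * M i j = (w i - w j) * (D.y i + D.y j)) ∧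
      (∀ i j, (D.y i - D.y j) * M i j = (w i - w j) * D.slope i j) ∧
      ∀ a b u v, u ∈ D.dualFil a → v ∈ D.dualFil b → r < a + b → form M u v = 0 := by
  induction hw using Submodule.span_induction with
  | mem w h =>
    obtain ⟨l, hl, rfl⟩ := h
    have hl' : l < r := hl
    exact ⟨D.kernel l, D.x_sub_mul_kernel l, D.y_sub_mul_kernel l, fun a b u v hu hv h =>
      D.form_kernel_eq_zero hu hv (by omega)⟩
  | zero => exact ⟨fun _ _ => 0, by simp, by simp, by simp [form]⟩
  | add w w' _ _ h h' =>
    obtain ⟨M, h1, h2, h3⟩ := h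
    obtain ⟨M', h1', h2', h3'⟩ := h'
    refine ⟨fun i j => M i j + M' i j, fun i j => ?_, fun i j => ?_, fun a b u v hu hv h => ?_⟩
    · simp only [Pi.add_apply]; linear_combination h1 i j + h1' i j
    · simp only [Pi.add_apply]; linear_combination h2 i j + h2' i j
    · rw [form_add, h3 a b u v hu hv h, h3' a b u v hu hv h, add_zero]
  | smul c w _ h =>
    obtain ⟨M, h1, h2, h3⟩ := h
    refine ⟨fun i j => c * M i j, fun i j => ?_, fun i j => ?_, fun a b u v hu hv h => ?_⟩
    · simp only [Pi.smul_apply, smul_eq_mul]; linear_combination c * h1 i j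
    · simp only [Pi.smul_apply, smul_eq_mul]; linear_combination c * h2 i j
    · rw [form_const_mul, h3 a b u v hu hv h, mul_zero]

/-- Differentiating a function of pole order `r` that vanishes at all the points gives a vector
which detects products of vectors whose values add up to `r + 1`. -/
theorem exists_pairing {r : ℕ} (hr : D.IsLead r) : ∃ z : ι → F,
    (∀ a b u v, u ∈ D.dualFil a → v ∈ D.dualFil b → r + 1 < a + b → z ⬝ᵥ (u * v) = 0) ∧
    (∀ a b u v, D.HasVal u a → D.HasVal v b → a + b = r + 1 → z ⬝ᵥ (u * v) ≠ 0) := by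
  obtain ⟨M, h1, h2, h3⟩ := D.exists_kernel_of_mem_below hr.2
  have hoff : ∀ i j, i ≠ j → D.kernel r i j - M i j = 0 := by
    intro i j hij
    by_cases hx : D.x i = D.x j
    · have hy : D.y i - D.y j ≠ 0 := sub_ne_zero.2 fun hy => hij (D.inj i j hx hy)
      refine (mul_eq_zero.1 ?_).resolve_left hy
      linear_combination D.y_sub_mul_kernel r i j - h2 i j
    · refine (mul_eq_zero.1 ?_).resolve_left (sub_ne_zero.2 hx)
      linear_combination D.x_sub_mul_kernel r i j - h1 i j
  have key : ∀ u v : ι → F, (fun i => D.kernel r i i - M i i) ⬝ᵥ (u * v) =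
      form (D.kernel r) u v - form M u v := by
    intro u v
    simp only [form, dotProduct, ← Finset.sum_sub_distrib, Pi.mul_apply]
    refine Finset.sum_congr rfl fun i _ => ?_
    rw [Finset.sum_eq_single i]
    · ring
    · intro j _ hj
      rw [← mul_sub, hoff i j hj.symm, mul_zero]
    · simp
  refine ⟨fun i => D.kernel r i i - M i i, fun a b u v hu hv h => ?_, fun a b u v hu hv h => ?_⟩
  · rw [key, D.form_kernel_eq_zero hu hv h, h3 a b u v hu hv (by omega), sub_zero]
  · rw [key, h3 a b u v hu.1 hv.1 (by omega), sub_zero]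
    exact D.form_kernel_ne_zero hr.1 hu hv h

omit [Fintype ι] in
theorem mono_mul_mem {N : ℕ} {w : ι → F} (hw : w ∈ D.below N) (i : ℕ) :
    D.mono i * w ∈ D.below (N + i) := by
  induction i using Nat.strong_induction_on generalizing w N with
  | _ i ih =>
    match i with
    | 0 => simpa [mono] using hw
    | 1 => simp [mono]
    | 2 => exact D.x_mul_mem hw
    | 3 => exact D.y_mul_mem hw
    | (i + 4) =>
      rw [mono, mul_comm D.x, mul_assoc]
      exact D.below_mono (by omega) (ih (i + 2) (by omega) (D.x_mul_mem hw))

omit [Fintype ι] in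
theorem below_mul_below_le (M N : ℕ) : D.below (M + 1) * D.below (N + 1) ≤ D.below (M + N + 1) := by
  refine Submodule.mul_le.2 fun u hu v hv => ?_
  induction hu using Submodule.span_induction with
  | mem u h =>
    obtain ⟨l, hl, rfl⟩ := h
    have hl' : l < M + 1 := hl
    exact D.below_mono (by omega) (D.mono_mul_mem hv l)
  | zero => simp
  | add a b _ _ ha hb => rw [add_mul]; exact add_mem ha hb
  | smul c a _ ha => rw [smul_mul_assoc]; exact Submodule.smul_mem _ _ ha

theorem finrank_below_mul_below_le (k : ℕ) (hk : k ≠ 0) :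
    finrank F (D.below (k + 1) * D.below (k + 1) : Submodule F (ι → F)) ≤ 2 * k := by
  refine (Submodule.finrank_mono (D.below_mul_below_le k k)).trans ?_
  have := D.finrank_span_mono_le (Finset.range (k + k + 1))
  rw [Finset.card_erase_of_mem (by simp; omega), Finset.card_range, Finset.coe_range] at this
  exact this.trans (by omega)

/-- The generators of a twisted code, indexed by their pole orders. -/
def twistedGen (k s : ℕ) (η : F) (j : ℕ) : ι → F :=
  if j = k + 1 then D.mono s + η • D.mono (k + 1) else D.mono j

/-- The twisted code in which `e_s` and `e_{k+1}` are replaced by `e_s + η e_{k+1}`, where `e_j` is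
the monomial of pole order `j`. -/
def twisted (k s : ℕ) (η : F) : Submodule F (ι → F) :=
  Submodule.span F (D.twistedGen k s η '' {j | j ≤ k + 1 ∧ j ≠ s})

omit [Fintype ι] in
theorem twistedGen_mem {k s : ℕ} {η : F} {j : ℕ} (hj : j ≤ k + 1) (hs : j ≠ s) :
    D.twistedGen k s η j ∈ D.twisted k s η :=
  Submodule.subset_span ⟨j, ⟨hj, hs⟩, rfl⟩

omit [Fintype ι] in
theorem exists_twistedGen_eq {k s : ℕ} {η : F} (hη : η ≠ 0) (hs : s ≤ k) (j : ℕ) :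
    ∃ κ : F, κ ≠ 0 ∧ ∃ w ∈ D.below j, D.twistedGen k s η j = κ • D.mono j + w := by
  by_cases h : j = k + 1
  · subst h
    exact ⟨η, hη, D.mono s, D.mono_mem_below (by omega), by rw [twistedGen, if_pos rfl, add_comm]⟩
  · exact ⟨1, one_ne_zero, 0, zero_mem _, by rw [twistedGen, if_neg h, one_smul, add_zero]⟩

omit [Fintype ι] in
theorem exists_twistedGen_mul_eq {k s : ℕ} {η : F} (hη : η ≠ 0) (hs : s ≤ k) (i j : ℕ) :
    ∃ κ : F, κ ≠ 0 ∧ ∃ w ∈ D.below (i + j),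
      D.twistedGen k s η i * D.twistedGen k s η j = κ • (D.mono i * D.mono j) + w := by
  obtain ⟨κ, hκ, w, hw, e⟩ := D.exists_twistedGen_eq hη hs i
  obtain ⟨κ', hκ', w', hw', e'⟩ := D.exists_twistedGen_eq hη hs j
  have hww : w * w' ∈ D.below (i + j) := by
    rcases Nat.eq_zero_or_pos i with rfl | hi
    · obtain rfl : w = 0 := by simpa [below] using hw
      simp
    rcases Nat.eq_zero_or_pos j with rfl | hj
    · obtain rfl : w' = 0 := by simpa [below] using hw'
      simp
    obtain ⟨i, rfl⟩ : ∃ l, i = l + 1 := ⟨i - 1, by omega⟩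
    obtain ⟨j, rfl⟩ : ∃ l, j = l + 1 := ⟨j - 1, by omega⟩
    exact D.below_mono (by omega) (D.below_mul_below_le i j (Submodule.mul_mem_mul hw hw'))
  refine ⟨κ * κ', mul_ne_zero hκ hκ', κ' • (D.mono j * w) + κ • (D.mono i * w') + w * w',
    add_mem (add_mem (Submodule.smul_mem _ _ (D.mono_mul_mem hw j))
      (Submodule.smul_mem _ _ (D.below_mono (by omega) (D.mono_mul_mem hw' i)))) hww, ?_⟩
  rw [e, e']
  ext l
  simp only [Pi.mul_apply, Pi.add_apply, Pi.smul_apply, smul_eq_mul]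
  ring

theorem le_finrank_twisted_mul_twisted {k s : ℕ} {η : F} (hη : η ≠ 0) (hk : Odd k) (hk5 : 5 ≤ k)
    (hs : Odd s) (hs3 : 3 ≤ s) (hsk : s ≤ k) (hn : 2 * k + 4 ≤ Fintype.card ι) :
    2 * k + 1 ≤ finrank F (D.twisted k s η * D.twisted k s η : Submodule F (ι → F)) := by
  obtain ⟨b, hb⟩ : ∃ b, b = if s = 3 then 3 else 2 * k + 1 := ⟨_, rfl⟩
  have hbk : b < 2 * k + 3 ∧ b ≠ 1 := by split_ifs at hb <;> omega
  have hsum : ∀ t, ∃ ij : ℕ × ℕ, t ∈ ((Finset.range (2 * k + 3)).erase 1).erase b →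
      (ij.1 + ij.2 = t ∧ ij.1 ≤ k + 1 ∧ ij.2 ≤ k + 1 ∧ ij.1 ≠ s ∧ ij.2 ≠ s ∧
        ij.1 ≠ 1 ∧ ij.2 ≠ 1) := by
    intro t
    obtain ⟨c, rfl⟩ := hk
    obtain ⟨d, rfl⟩ := hs
    by_cases h1 : t ≤ 2 * c + 1 + 1
    · by_cases h2 : t = 2 * d + 1
      · refine ⟨(t - 2, 2), fun ht => ?_⟩
        simp only [Finset.mem_erase, Finset.mem_range] at ht
        split_ifs at hb <;> omega
      · refine ⟨(t, 0), fun ht => ?_⟩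
        simp only [Finset.mem_erase, Finset.mem_range] at ht
        omega
    · by_cases h2 : t = 2 * c + 3
      · by_cases h3 : c = d
        · refine ⟨(2 * c, 3), fun ht => ?_⟩
          simp only [Finset.mem_erase, Finset.mem_range] at ht
          split_ifs at hb <;> omega
        · refine ⟨(2 * c + 1, 2), fun ht => ?_⟩
          simp only [Finset.mem_erase, Finset.mem_range] at ht
          split_ifs at hb <;> omega
      · by_cases h3 : t = 2 * c + 2 + (2 * d + 1)
        · refine ⟨(2 * c + 1, 2 * d + 2), fun ht => ?_⟩
          simp only [Finset.mem_erase, Finset.mem_range] at ht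
          split_ifs at hb <;> omega
        · refine ⟨(2 * c + 2, t - (2 * c + 2)), fun ht => ?_⟩
          simp only [Finset.mem_erase, Finset.mem_range] at ht
          split_ifs at hb <;> omega
  choose ij hij using hsum
  have hval : ∀ t, ∃ u : ι → F, t ∈ ((Finset.range (2 * k + 3)).erase 1).erase b →
      D.HasVal u t := by
    intro t
    by_cases ht : t ∈ ((Finset.range (2 * k + 3)).erase 1).erase b
    · simp only [Finset.mem_erase, Finset.mem_range] at ht
      obtain ⟨u, hu⟩ := D.exists_hasVal (D.not_isLead_of_lt (r := t) (by omega)) ht.2.1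
      exact ⟨u, fun _ => hu⟩
    · exact ⟨0, fun h => absurd h ht⟩
  choose u hu using hval
  have hcard : (((Finset.range (2 * k + 3)).erase 1).erase b).card = 2 * k + 1 := by
    rw [Finset.card_erase_of_mem (by simp; omega), Finset.card_erase_of_mem (by simp),
      Finset.card_range]
    omega
  have key := card_add_finrank_le_of_triangular (I := ℕᵒᵈ)
    (((Finset.range (2 * k + 3)).erase 1).erase b)
    (fun t => dotProductBilin F F (u t))
    (fun t => D.twistedGen k s η (ij t).1 * D.twistedGen k s η (ij t).2) ⊥
    (D.twisted k s η * D.twisted k s η) bot_le ?_ ?_ ?_ ?_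
  · exact hcard.ge.trans ((Nat.le_add_right _ _).trans key)
  · intro t ht
    obtain ⟨-, h1, h2, h3, h4, -⟩ := hij t ht
    exact Submodule.mul_mem_mul (D.twistedGen_mem h1 h3) (D.twistedGen_mem h2 h4)
  · intro t ht
    obtain ⟨h0, h1, h2, h3, h4, h5, h6⟩ := hij t ht
    obtain ⟨κ, hκ, w, hw, e⟩ := D.exists_twistedGen_mul_eq hη hsk (ij t).1 (ij t).2
    have hut : D.HasVal (u t) ((ij t).1 + (ij t).2) := by rw [h0]; exact hu t ht
    simp only [dotProductBilin_apply_apply]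
    rw [e, dotProduct_add, D.dotProduct_below hut.1 hw, add_zero, dotProduct_smul]
    exact smul_ne_zero hκ (hut.dotProduct_mono_mul h5 h6)
  · intro t ht t' ht' htt
    obtain ⟨h0, h1, h2, h3, h4, h5, h6⟩ := hij t ht
    obtain ⟨κ, hκ, w, hw, e⟩ := D.exists_twistedGen_mul_eq hη hsk (ij t).1 (ij t).2
    have hlt : (ij t).1 + (ij t).2 < t' := by rw [h0]; exact htt
    simp only [dotProductBilin_apply_apply]
    rw [e, dotProduct_add, D.dotProduct_below (hu t' ht').1 (D.below_mono hlt.le hw), add_zero,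
      dotProduct_smul, D.dotProduct_mono_mul (hu t' ht').1 hlt, smul_zero]
  · simp

open Classical in
/-- The vector obtained by differentiating a function of pole order `r` that vanishes at all the
points, if there is one. -/
noncomputable def pairVec (r : ℕ) : ι → F :=
  if h : D.IsLead r then (D.exists_pairing h).choose else 0

theorem pairVec_dotProduct_eq_zero {r a b : ℕ} {u v : ι → F} (hr : D.IsLead r)
    (hu : u ∈ D.dualFil a) (hv : v ∈ D.dualFil b) (h : r + 1 < a + b) :
    D.pairVec r ⬝ᵥ (u * v) = 0 := by
  rw [pairVec, dif_pos hr]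
  exact (D.exists_pairing hr).choose_spec.1 a b u v hu hv h

theorem pairVec_dotProduct_ne_zero {r a b : ℕ} {u v : ι → F} (hr : D.IsLead r)
    (hu : D.HasVal u a) (hv : D.HasVal v b) (h : a + b = r + 1) :
    D.pairVec r ⬝ᵥ (u * v) ≠ 0 := by
  rw [pairVec, dif_pos hr]
  exact (D.exists_pairing hr).choose_spec.2 a b u v hu hv h

theorem card_add_finrank_le {S : Finset ℕ} {P Q : Submodule F (ι → F)} (hQP : Q ≤ P)
    (hS : ∀ r ∈ S, D.IsLead r)
    (h : ∀ r ∈ S, ∃ a b u v, D.HasVal u a ∧ D.HasVal v b ∧ a + b = r + 1 ∧ u * v ∈ P)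
    (hQ : ∀ r ∈ S, ∀ q ∈ Q, D.pairVec r ⬝ᵥ q = 0) : S.card + finrank F Q ≤ finrank F P := by
  have h' : ∀ r, ∃ p, r ∈ S → ∃ a b u v, D.HasVal u a ∧ D.HasVal v b ∧ a + b = r + 1 ∧
      p ∈ P ∧ p = u * v := by
    intro r
    by_cases hr : r ∈ S
    · obtain ⟨a, b, u, v, h1, h2, h3, h4⟩ := h r hr
      exact ⟨u * v, fun _ => ⟨a, b, u, v, h1, h2, h3, h4, rfl⟩⟩
    · exact ⟨0, fun h => absurd h hr⟩
  choose p hp using h'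
  refine card_add_finrank_le_of_triangular S (fun r => dotProductBilin F F (D.pairVec r)) p Q P
    hQP ?_ ?_ ?_ hQ
  · intro r hr
    obtain ⟨a, b, u, v, -, -, -, h4, -⟩ := hp r hr
    exact h4
  · intro r hr
    obtain ⟨a, b, u, v, h1, h2, h3, -, e⟩ := hp r hr
    simp only [dotProductBilin_apply_apply, e]
    exact D.pairVec_dotProduct_ne_zero (hS r hr) h1 h2 h3
  · intro r hr r' hr' hlt
    obtain ⟨a, b, u, v, h1, h2, h3, -, e⟩ := hp r hr
    simp only [dotProductBilin_apply_apply, e]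
    exact D.pairVec_dotProduct_eq_zero (hS r' hr') h1.1 h2.1 (by omega)

theorem exists_hasVal_of_lt {v : ℕ} (h : v < Fintype.card ι) (hv : v ≠ 1) : ∃ u, D.HasVal u v :=
  D.exists_hasVal (D.not_isLead_of_lt h) hv

theorem finrank_dualFil_mul_dualFil_le {k : ℕ} (hk : Fintype.card ι + 1 ≤ 2 * k)
    (hkn : k + 2 ≤ Fintype.card ι) :
    finrank F (D.dualFil (k + 1) * D.dualFil (k + 1) : Submodule F (ι → F)) ≤
      2 * (Fintype.card ι - k) := by
  obtain ⟨b, hb, hlead⟩ : ∃ b, (b = Fintype.card ι ∨ b = Fintype.card ι + 1) ∧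
      ∀ r, Fintype.card ι ≤ r → r ≠ b → D.IsLead r := by
    by_cases h : D.IsLead (Fintype.card ι)
    · refine ⟨_, Or.inr rfl, fun r h1 h2 => ?_⟩
      obtain rfl | h3 : r = Fintype.card ι ∨ Fintype.card ι + 2 ≤ r := by omega
      · exact h
      · exact D.isLead_of_card_add_two_le h3
    · exact ⟨_, Or.inl rfl, fun r h1 h2 => D.isLead_of_card_lt h (by omega) (by omega)⟩
  have key := D.card_add_finrank_le (S := (Finset.Icc (Fintype.card ι) (2 * k)).erase b)
    (P := ⊤) (Q := D.dualFil (k + 1) * D.dualFil (k + 1)) le_top ?_ ?_ ?_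
  · rw [Finset.card_erase_of_mem (by simp; omega), Nat.card_Icc, finrank_top,
      finrank_fintype_fun_eq_card] at key
    omega
  · intro r hr
    simp only [Finset.mem_erase, Finset.mem_Icc] at hr
    exact hlead r hr.2.1 hr.1
  · intro r hr
    simp only [Finset.mem_erase, Finset.mem_Icc] at hr
    obtain ⟨u, hu⟩ := D.exists_hasVal_of_lt (v := Fintype.card ι - 1) (by omega) (by omega)
    obtain ⟨v, hv⟩ := D.exists_hasVal_of_lt (v := r + 2 - Fintype.card ι) (by omega) (by omega)
    exact ⟨_, _, u, v, hu, hv, by omega, trivial⟩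
  · intro r hr q hq
    simp only [Finset.mem_erase, Finset.mem_Icc] at hr
    have : D.dualFil (k + 1) * D.dualFil (k + 1) ≤
        LinearMap.ker (dotProductBilin F F (D.pairVec r)) :=
      Submodule.mul_le.2 fun u hu v hv =>
        D.pairVec_dotProduct_eq_zero (hlead r hr.2.1 hr.1) hu hv (by omega)
    exact this hq

omit D in
/-- The dual code. -/
def dualCode (C : Submodule F (ι → F)) : Submodule F (ι → F) where
  carrier := {u | ∀ c ∈ C, u ⬝ᵥ c = 0}
  add_mem' := fun hu hv c hc => by rw [add_dotProduct, hu c hc, hv c hc, add_zero]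
  zero_mem' := fun _ _ => zero_dotProduct _
  smul_mem' := fun a u hu c hc => by rw [smul_dotProduct, hu c hc, smul_zero]

theorem dualCode_below_le (N : ℕ) : dualCode (D.below N) ≤ D.dualFil N :=
  fun _ hu _ hl => hu _ (D.mono_mem_below hl)

omit D [Fintype ι] in
theorem finrank_mul_le_of_monomial [Finite ι] {P Q : Submodule F (ι → F)} (σ : Equiv.Perm ι)
    {w : ι → F} (hw : ∀ i, w i ≠ 0) (h : ∀ c ∈ P, (fun i => w i * c (σ i)) ∈ Q) :
    finrank F (P * P : Submodule F (ι → F)) ≤ finrank F (Q * Q : Submodule F (ι → F)) := by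
  let T : (ι → F) →ₗ[F] (ι → F) := LinearMap.mulLeft F (w * w) ∘ₗ LinearMap.funLeft F F σ
  have hT : Function.Injective T := by
    refine (injective_iff_map_eq_zero T).2 fun c hc => ?_
    ext i
    have := congrFun hc (σ.symm i)
    simpa [T, LinearMap.funLeft_apply, hw] using this
  rw [(Submodule.equivMapOfInjective T hT _).finrank_eq]
  refine Submodule.finrank_mono (Submodule.map_le_iff_le_comap.2 (Submodule.mul_le.2 ?_))
  intro c hc d hd
  have : T (c * d) = (fun i => w i * c (σ i)) * (fun i => w i * d (σ i)) := by
    ext i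
    simp only [T, LinearMap.comp_apply, LinearMap.mulLeft_apply, Pi.mul_apply,
      LinearMap.funLeft_apply]
    ring
  rw [Submodule.mem_comap, this]
  exact Submodule.mul_mem_mul (h c hc) (h d hd)

omit D in
theorem finrank_dualCode_mul_le_of_monomial {C C' : Submodule F (ι → F)} (σ : Equiv.Perm ι)
    {w : ι → F} (hw : ∀ i, w i ≠ 0) (h : ∀ c' ∈ C', ∃ c ∈ C, c' = fun i => w i * c (σ i)) :
    finrank F (dualCode C * dualCode C : Submodule F (ι → F)) ≤
      finrank F (dualCode C' * dualCode C' : Submodule F (ι → F)) := by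
  refine finrank_mul_le_of_monomial σ (w := w⁻¹) (fun i => inv_ne_zero (hw i)) ?_
  intro u hu c' hc'
  obtain ⟨c, hc, rfl⟩ := h c' hc'
  rw [← hu c hc, dotProduct, dotProduct, ← Equiv.sum_comp σ fun i => u i * c i]
  refine Finset.sum_congr rfl fun i _ => ?_
  have := hw i
  simp only [Pi.inv_apply]
  field_simp

/-- The points with indices in the image of an injective map. -/
def comap {κ : Type*} (φ : κ → ι) (hφ : Function.Injective φ) : CubicPoints κ F where
  x := D.x ∘ φ
  y := D.y ∘ φ
  c₀ := D.c₀
  c₁ := D.c₁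
  c₂ := D.c₂
  c₃ := D.c₃
  lead_ne := D.lead_ne
  curve i := D.curve (φ i)
  inj _ _ hx hy := hφ (D.inj _ _ hx hy)

omit [Fintype ι] in
theorem comap_mono {κ : Type*} (φ : κ → ι) (hφ : Function.Injective φ) (j : ℕ) (i : κ) :
    (D.comap φ hφ).mono j i = D.mono j (φ i) := by
  induction j using Nat.strong_induction_on with
  | _ j ih =>
    match j with
    | 0 => simp [mono]
    | 1 => simp [mono]
    | 2 => rfl
    | 3 => rfl
    | (j + 4) =>
      rw [mono, mono, Pi.mul_apply, Pi.mul_apply, ih (j + 2) (by omega)]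
      rfl

variable {D} in
theorem HasVal.lt_card_support_add_two {u : ι → F} {v : ℕ} (hu : D.HasVal u v)
    [Fintype {i // u i ≠ 0}] : v < Fintype.card {i // u i ≠ 0} + 2 := by
  classical
  by_contra! hlt
  have htop := (D.comap (fun i : {i // u i ≠ 0} => i.1) Subtype.val_injective).below_card_add_two
  have hbot := dualFil_eq_bot _ (top_le_iff.1 (htop.ge.trans (below_mono _ hlt)))
  have hmem : (fun i : {i // u i ≠ 0} => u i) ∈
      (D.comap (fun i : {i // u i ≠ 0} => i.1) Subtype.val_injective).dualFil v := by
    intro l hl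
    refine Eq.trans ?_ (hu.1 l hl)
    rw [dotProduct, dotProduct,
      ← Finset.sum_filter_of_ne (p := fun i => u i ≠ 0) (fun i _ h => left_ne_zero_of_mul h),
      Finset.sum_subtype (p := fun i => u i ≠ 0) _ (by simp)]
    exact Finset.sum_congr rfl fun i _ => by rw [comap_mono]
  rw [hbot, Submodule.mem_bot] at hmem
  refine hu.2 ?_
  have : u = 0 := by
    ext i
    by_contra hi
    exact hi (congrFun hmem ⟨i, hi⟩)
  rw [this, zero_dotProduct]

/-- If `IsLead (card ι)` fails, the products of two dual vectors span one more dimension than is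
seen by the differentials alone. -/
theorem exists_mem_mul_pairVec_eq_zero (h2 : (2 : F) ≠ 0) {f : F[X]} (hf : f.Separable)
    (hf3 : f.natDegree = 3) (hfc : ∀ i, D.y i ^ 2 = f.eval (D.x i))
    (hn : ¬ D.IsLead (Fintype.card ι)) {k : ℕ} (hk : k + 4 ≤ Fintype.card ι)
    (h8 : 8 ≤ Fintype.card ι) :
    ∃ e ∈ (D.dualFil (k + 2) * D.dualFil (k + 2) : Submodule F (ι → F)), e ≠ 0 ∧
      ∀ r, D.IsLead r → r < 2 * Fintype.card ι → D.pairVec r ⬝ᵥ e = 0 := by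
  classical
  obtain ⟨a, ha⟩ := D.exists_hasVal hn (by omega)
  obtain ⟨b, hb⟩ := D.exists_hasVal_of_lt (v := Fintype.card ι - 1) (by omega) (by omega)
  obtain ⟨n, hnn⟩ : ∃ n, Fintype.card ι = n + 3 := ⟨Fintype.card ι - 3, by omega⟩
  have hlead : ∀ r, n + 3 < r → D.IsLead r := fun r hr =>
    D.isLead_of_card_lt hn (by omega) (by omega)
  rw [hnn] at ha hb
  have hb : D.HasVal b (n + 2) := hb
  have hxa : D.HasVal (D.x * a) (n + 1) := HasVal.x_mul (j := n + 1) ha (by omega)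
  have hxb : D.HasVal (D.x * b) n := hb.x_mul (by omega)
  have hya : D.HasVal (D.y * a) n := ha.y_mul (by omega)
  have z1 := D.pairVec_dotProduct_ne_zero (hlead (2 * n + 3) (by omega)) hb hb (by omega)
  have z1' := D.pairVec_dotProduct_ne_zero (hlead (2 * n + 3) (by omega)) hxa ha (by omega)
  have z2 := D.pairVec_dotProduct_ne_zero (hlead (2 * n + 4) (by omega)) ha hb (by omega)
  have z3 := D.pairVec_dotProduct_ne_zero (hlead (2 * n + 5) (by omega)) ha ha (by omega)
  obtain ⟨t, ht⟩ : ∃ t : F, D.pairVec (2 * n + 3) ⬝ᵥ (D.x * a * a) =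
      t * D.pairVec (2 * n + 3) ⬝ᵥ (b * b) := ⟨_, (div_mul_cancel₀ _ z1).symm⟩
  have ht0 : t ≠ 0 := by rintro rfl; rw [zero_mul] at ht; exact z1' ht
  obtain ⟨t', ht'⟩ : ∃ t' : F, D.pairVec (2 * n + 4) ⬝ᵥ (D.x * a * a - t • (b * b)) =
      t' * D.pairVec (2 * n + 4) ⬝ᵥ (a * b) := ⟨_, (div_mul_cancel₀ _ z2).symm⟩
  obtain ⟨t'', ht''⟩ : ∃ t'' : F,
      D.pairVec (2 * n + 5) ⬝ᵥ (D.x * a * a - t • (b * b) - t' • (a * b)) =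
      t'' * D.pairVec (2 * n + 5) ⬝ᵥ (a * a) := ⟨_, (div_mul_cancel₀ _ z3).symm⟩
  have mem : ∀ {u v}, D.HasVal u v → k + 2 ≤ v → u ∈ D.dualFil (k + 2) :=
    fun h hv => D.dualFil_anti hv h.1
  have mem_a := mem ha (by omega)
  have mem_b := mem hb (by omega)
  refine ⟨D.x * a * a - t • (b * b) - t' • (a * b) - t'' • (a * a),
    sub_mem (sub_mem (sub_mem (Submodule.mul_mem_mul (mem hxa (by omega)) mem_a)
      (Submodule.smul_mem _ _ (Submodule.mul_mem_mul mem_b mem_b)))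
      (Submodule.smul_mem _ _ (Submodule.mul_mem_mul mem_a mem_b)))
      (Submodule.smul_mem _ _ (Submodule.mul_mem_mul mem_a mem_a)), ?_, ?_⟩
  · intro he
    obtain ⟨τ, m1⟩ := hxb.exists_sub_mem hya.1
    obtain ⟨τ', m2⟩ := hxa.exists_sub_mem m1
    obtain ⟨τ'', m3⟩ := hb.exists_sub_mem m2
    obtain ⟨τ''', m4⟩ := ha.exists_sub_mem m3
    have hbot := D.dualFil_eq_bot (D.below_card_succ hn)
    rw [hnn] at hbot
    rw [hbot, Submodule.mem_bot] at m4
    let p : F[X] := C t * X ^ 2 + C t' * X + C t''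
    let q : F[X] := (C τ * X + C τ') * p + (C τ'' * X + C τ''')
    have hx : ∀ i, a i ≠ 0 → D.x i = p.eval (b i / a i) := by
      intro i hi
      have := congrFun he i
      simp only [Pi.sub_apply, Pi.mul_apply, Pi.smul_apply, smul_eq_mul, Pi.zero_apply] at this
      simp only [p, eval_add, eval_mul, eval_C, eval_X, eval_pow]
      field_simp
      linear_combination this
    have hy : ∀ i, a i ≠ 0 → D.y i = q.eval (b i / a i) := by
      intro i hi
      have := congrFun m4 i
      simp only [Pi.sub_apply, Pi.mul_apply, Pi.smul_apply, smul_eq_mul, Pi.zero_apply] at this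
      simp only [q, eval_add, eval_mul, eval_C, eval_X, ← hx i hi]
      field_simp
      linear_combination this
    have hp2 : p.natDegree = 2 := natDegree_quadratic ht0
    have hq3 : q.natDegree ≤ 3 := by
      refine natDegree_add_le_of_degree_le ?_ (natDegree_linear_le.trans (by omega))
      exact natDegree_mul_le_of_le (m := 1) (n := 2) natDegree_linear_le hp2.le
    refine sq_ne_comp_of_separable h2 hf hf3 hp2 (q := q) (sub_eq_zero.1 ?_)
    refine eq_zero_of_natDegree_lt_card_of_eval_eq_zero (ι := {i // a i ≠ 0}) _
      (f := fun i => b i.1 / a i.1) ?_ ?_ ?_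
    · intro i j hij
      refine Subtype.ext (D.inj _ _ ?_ ?_)
      · rw [hx _ i.2, hx _ j.2]; exact congrArg p.eval hij
      · rw [hy _ i.2, hy _ j.2]; exact congrArg q.eval hij
    · intro i
      rw [eval_sub, eval_pow, eval_comp, ← hx _ i.2, ← hy _ i.2, hfc, sub_self]
    · have hs := ha.lt_card_support_add_two
      have hd := natDegree_sub_le (q ^ 2) (f.comp p)
      rw [natDegree_comp, hf3, hp2] at hd
      have hq6 := natDegree_pow_le_of_le 2 hq3
      exact lt_of_le_of_lt (hd.trans (max_le hq6 le_rfl)) (by omega)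
  · intro r hr hlt
    have kill : ∀ {i j u v}, D.HasVal u i → D.HasVal v j → r + 1 < i + j →
        D.pairVec r ⬝ᵥ (u * v) = 0 :=
      fun hu hv h => D.pairVec_dotProduct_eq_zero hr hu.1 hv.1 h
    obtain h | rfl | rfl | rfl :
        r < 2 * n + 3 ∨ r = 2 * n + 3 ∨ r = 2 * n + 4 ∨ r = 2 * n + 5 := by omega
    · simp only [dotProduct_sub, dotProduct_smul]
      rw [kill hxa ha (by omega), kill hb hb (by omega), kill ha hb (by omega),
        kill ha ha (by omega)]
      simp
    · simp only [dotProduct_sub, dotProduct_smul]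
      rw [kill ha hb (by omega), kill ha ha (by omega), ht]
      simp
    · rw [dotProduct_sub, dotProduct_sub, ht', dotProduct_smul, dotProduct_smul,
        kill ha ha (by omega)]
      simp
    · rw [dotProduct_sub, ht'', dotProduct_smul]
      simp

theorem mem_dualCode_twisted {k s : ℕ} {η : F} {u : ι → F}
    (h : ∀ j ≤ k + 1, j ≠ s → u ⬝ᵥ D.twistedGen k s η j = 0) : u ∈ dualCode (D.twisted k s η) := by
  intro c hc
  induction hc using Submodule.span_induction with
  | mem c h' => obtain ⟨j, ⟨hj, hjs⟩, rfl⟩ := h'; exact h j hj hjs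
  | zero => exact dotProduct_zero u
  | add a b _ _ ha hb => rw [dotProduct_add, ha, hb, add_zero]
  | smul a b _ hb => rw [dotProduct_smul, hb, smul_zero]

theorem dualFil_le_dualCode_twisted {k s : ℕ} (η : F) (hs : s ≤ k) :
    D.dualFil (k + 2) ≤ dualCode (D.twisted k s η) := by
  refine fun u hu => D.mem_dualCode_twisted fun j hj _ => ?_
  rw [twistedGen]
  split_ifs
  · rw [dotProduct_add, dotProduct_smul, hu s (by omega), hu (k + 1) (by omega), smul_zero,
      add_zero]
  · exact hu j (by omega)

/-- The dual of the twisted code has an extra vector whose only nonzero pairings with monomials of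
pole order at most `k + 1` are those with the twisted monomials. -/
theorem exists_mem_dualCode_twisted {k s : ℕ} {η : F} (hη : η ≠ 0) (hs2 : 2 ≤ s) (hs : s ≤ k)
    (hk : k + 2 ≤ Fintype.card ι) : ∃ v ∈ dualCode (D.twisted k s η), D.HasVal v s ∧
      (∀ l ≤ k, l ≠ s → v ⬝ᵥ D.mono l = 0) ∧ v ⬝ᵥ D.mono (k + 1) ≠ 0 := by
  obtain ⟨v, hv⟩ := D.exists_dotProduct_eq (N := k + 2)
    (fun l hl => D.not_isLead_of_lt (lt_of_lt_of_le hl hk)) fun l => if l = s then -η else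
      if l = k + 1 then 1 else 0
  have hvs : v ⬝ᵥ D.mono s = -η := by rw [hv s (by omega) (by omega), if_pos rfl]
  have hv0 : ∀ l ≤ k, l ≠ s → v ⬝ᵥ D.mono l = 0 := by
    intro l hl hls
    by_cases h1 : l = 1
    · subst h1; exact D.dotProduct_mono_one v
    · rw [hv l (by omega) h1, if_neg hls, if_neg (by omega)]
  have hvk : v ⬝ᵥ D.mono (k + 1) = 1 := by
    rw [hv (k + 1) (by omega) (by omega), if_neg (by omega), if_pos rfl]
  refine ⟨v, D.mem_dualCode_twisted fun j hj hjs => ?_,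
    ⟨fun l hl => hv0 l (by omega) (by omega), ?_⟩, hv0, by rw [hvk]; exact one_ne_zero⟩
  · rw [twistedGen]
    split_ifs
    · rw [dotProduct_add, dotProduct_smul, hvs, hvk]
      simp
    · exact hv0 j (by omega) hjs
  · rw [hvs]; exact neg_ne_zero.2 hη

/-- The product of two vectors with values adding up to `r + 1` lies in `P`. -/
def IsProdVal (P : Submodule F (ι → F)) (r : ℕ) : Prop :=
  ∃ a b u v, D.HasVal u a ∧ D.HasVal v b ∧ a + b = r + 1 ∧ u * v ∈ P

theorem isProdVal_of_dualFil {k : ℕ} {P : Submodule F (ι → F)}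
    (hP : D.dualFil (k + 2) * D.dualFil (k + 2) ≤ P) {a b r : ℕ} (ha : ¬ D.IsLead a)
    (hb : ¬ D.IsLead b) (hka : k + 2 ≤ a) (hkb : k + 2 ≤ b) (h : a + b = r + 1) :
    D.IsProdVal P r := by
  obtain ⟨u, hu⟩ := D.exists_hasVal ha (by omega)
  obtain ⟨v, hv⟩ := D.exists_hasVal hb (by omega)
  exact ⟨a, b, u, v, hu, hv, h, hP (Submodule.mul_mem_mul (D.dualFil_anti hka hu.1)
    (D.dualFil_anti hkb hv.1))⟩

theorem isProdVal_of_hasVal {k s : ℕ} {P : Submodule F (ι → F)} {v : ι → F} (hv : D.HasVal v s)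
    (hP : ∀ u ∈ D.dualFil (k + 2), v * u ∈ P) {b r : ℕ}
    (hb : ¬ D.IsLead b) (hkb : k + 2 ≤ b) (h : s + b = r + 1) : D.IsProdVal P r := by
  obtain ⟨u, hu⟩ := D.exists_hasVal hb (by omega)
  exact ⟨s, b, v, u, hv, hu, h, hP u (D.dualFil_anti hkb hu.1)⟩

theorem hasVal_x_mul_of_three {k : ℕ} {v : ι → F} (hk : 5 ≤ k)
    (h0 : ∀ l ≤ k, l ≠ 3 → v ⬝ᵥ D.mono l = 0) (h1 : v ⬝ᵥ D.mono (k + 1) ≠ 0) :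
    D.HasVal (D.x * v) (k - 1) := by
  refine ⟨fun l hl => ?_, ?_⟩
  · by_cases hl1 : l = 1
    · subst hl1; exact D.dotProduct_mono_one _
    · rw [D.x_mul_dotProduct hl1]; exact h0 _ (by omega) (by omega)
  · rw [D.x_mul_dotProduct (by omega), show k - 1 + 2 = k + 1 by omega]; exact h1

theorem exists_three_isProdVal {k s : ℕ} {P : Submodule F (ι → F)} {v : ι → F}
    (hk : Odd k) (hs : Odd s) (hs3 : 3 ≤ s) (hsk : s ≤ k) (hk7 : 7 ≤ k)
    (hn : Fintype.card ι + 3 ≤ 2 * k) (hkn : k + 4 ≤ Fintype.card ι)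
    (hv : D.HasVal v s) (hv0 : ∀ l ≤ k, l ≠ s → v ⬝ᵥ D.mono l = 0) (hvk : v ⬝ᵥ D.mono (k + 1) ≠ 0)
    (hP : ∀ u ∈ D.dualFil (k + 2), v * u ∈ P) (hPv : v * v ∈ P)
    (hex : ¬ (D.IsLead (Fintype.card ι) ∧ s = 3 ∧ Fintype.card ι = k + 4)) :
    ∃ r₁ r₂ r₃, r₁ < r₂ ∧ r₂ < r₃ ∧ r₃ ≤ 2 * k + 2 ∧
      ∀ r ∈ ({r₁, r₂, r₃} : Finset ℕ), D.IsLead r ∧ D.IsProdVal P r := by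
  obtain ⟨c, rfl⟩ := hk
  obtain ⟨d, rfl⟩ := hs
  have hlt : ∀ r, r < Fintype.card ι → ¬ D.IsLead r := fun r => D.not_isLead_of_lt
  have hge : ∀ r, Fintype.card ι + 2 ≤ r → D.IsLead r := fun r => D.isLead_of_card_add_two_le
  have hprod : ∀ b r, ¬ D.IsLead b → 2 * c + 1 + 2 ≤ b → 2 * d + 1 + b = r + 1 →
      D.IsProdVal P r := fun b r => D.isProdVal_of_hasVal hv hP
  have key : ∀ r₁ r₂ r₃, r₁ < r₂ → r₂ < r₃ → r₃ ≤ 2 * (2 * c + 1) + 2 →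
      D.IsLead r₁ → D.IsLead r₂ → D.IsLead r₃ →
      D.IsProdVal P r₁ → D.IsProdVal P r₂ → D.IsProdVal P r₃ →
      ∃ r₁ r₂ r₃, r₁ < r₂ ∧ r₂ < r₃ ∧ r₃ ≤ 2 * (2 * c + 1) + 2 ∧
        ∀ r ∈ ({r₁, r₂, r₃} : Finset ℕ), D.IsLead r ∧ D.IsProdVal P r := by
    intro r₁ r₂ r₃ h1 h2 h3 l1 l2 l3 p1 p2 p3
    refine ⟨r₁, r₂, r₃, h1, h2, h3, fun r hr => ?_⟩
    simp only [Finset.mem_insert, Finset.mem_singleton] at hr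
    obtain rfl | rfl | rfl := hr
    exacts [⟨l1, p1⟩, ⟨l2, p2⟩, ⟨l3, p3⟩]
  by_cases hdc : d = c
  · subst hdc
    refine key (4 * d + 1) (4 * d + 3) (4 * d + 4) (by omega) (by omega) (by omega)
      (hge _ (by omega)) (hge _ (by omega)) (hge _ (by omega))
      ⟨_, _, v, v, hv, hv, by omega, hPv⟩
      (hprod (2 * d + 3) _ (hlt _ (by omega)) (by omega) (by omega))
      (hprod (2 * d + 4) _ (hlt _ (by omega)) (by omega) (by omega))
  have hlast : 2 * d + 1 = 3 → 2 * c + 5 < Fintype.card ι ∨ ¬ D.IsLead (2 * c + 5) →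
      D.IsProdVal P (2 * (2 * c + 1) + 2) := by
    intro h3 hlt5
    obtain rfl : d = 1 := by omega
    obtain ⟨u, hu⟩ := D.exists_hasVal (v := 2 * c + 3 + 2) (hlt5.elim (hlt _) id) (by omega)
    refine ⟨_, _, _, u, D.hasVal_x_mul_of_three (by omega) hv0 hvk, hu, by omega, ?_⟩
    rw [mul_comm D.x, mul_assoc]
    exact hP _ (hu.x_mul (by omega)).1
  by_cases hL : D.IsLead (Fintype.card ι)
  · have hL1 : ¬ D.IsLead (Fintype.card ι + 1) := fun h =>
      lt_irrefl _ (D.card_lt_of_isLead_succ hL h)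
    by_cases hd : d = 1
    · subst hd
      refine key (Fintype.card ι) (Fintype.card ι + 3) _ (by omega) (by omega) le_rfl hL
        (hge _ (by omega)) (hge _ (by omega))
        (hprod (Fintype.card ι - 2) _ (hlt _ (by omega)) (by omega) (by omega))
        (hprod (Fintype.card ι + 1) _ hL1 (by omega) (by omega)) (hlast rfl (Or.inl ?_))
      by_contra h
      exact hex ⟨hL, rfl, by omega⟩
    obtain ⟨b, hb⟩ : ∃ b, b = max (2 * c + 3) (Fintype.card ι + 2 - 2 * d) := ⟨_, rfl⟩
    by_cases hsn : 2 * d + 1 + Fintype.card ι + 1 ≤ 2 * (2 * c + 1) + 3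
    · exact key (2 * d + b) (2 * d + b + 1) (2 * d + 1 + Fintype.card ι) (by omega) (by omega)
        (by omega) (hge _ (by omega)) (hge _ (by omega)) (hge _ (by omega))
        (hprod b _ (hlt _ (by omega)) (by omega) (by omega))
        (hprod (b + 1) _ (hlt _ (by omega)) (by omega) (by omega))
        (hprod (Fintype.card ι + 1) _ hL1 (by omega) (by omega))
    · exact key (2 * d + b) (2 * d + b + 1) (2 * d + b + 2) (by omega) (by omega)
        (by omega) (hge _ (by omega)) (hge _ (by omega)) (hge _ (by omega))
        (hprod b _ (hlt _ (by omega)) (by omega) (by omega))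
        (hprod (b + 1) _ (hlt _ (by omega)) (by omega) (by omega))
        (hprod (b + 2) _ (hlt _ (by omega)) (by omega) (by omega))
  · have hge : ∀ r, Fintype.card ι < r → D.IsLead r := fun r hr =>
      D.isLead_of_card_lt hL hr (by omega)
    have hlt : ∀ r, r ≤ Fintype.card ι → ¬ D.IsLead r := fun r hr =>
      hr.lt_or_eq.elim (hlt r) fun h => h ▸ hL
    by_cases hd : d = 1
    · subst hd
      exact key (Fintype.card ι + 1) (Fintype.card ι + 2) _ (by omega) (by omega) le_rfl
        (hge _ (by omega)) (hge _ (by omega)) (hge _ (by omega))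
        (hprod (Fintype.card ι - 1) _ (hlt _ (by omega)) (by omega) (by omega))
        (hprod (Fintype.card ι) _ (hlt _ (by omega)) (by omega) (by omega))
        (hlast rfl (Or.inr (hlt _ (by omega))))
    · obtain ⟨b, hb⟩ : ∃ b, b = max (2 * c + 3) (Fintype.card ι + 1 - 2 * d) := ⟨_, rfl⟩
      exact key (2 * d + b) (2 * d + b + 1) (2 * d + b + 2) (by omega) (by omega)
        (by omega) (hge _ (by omega)) (hge _ (by omega)) (hge _ (by omega))
        (hprod b _ (hlt _ (by omega)) (by omega) (by omega))
        (hprod (b + 1) _ (hlt _ (by omega)) (by omega) (by omega))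
        (hprod (b + 2) _ (hlt _ (by omega)) (by omega) (by omega))

theorem lt_finrank_dualCode_twisted_mul {k s : ℕ} {η : F} (h2 : (2 : F) ≠ 0) {f : F[X]}
    (hf : f.Separable) (hf3 : f.natDegree = 3) (hfc : ∀ i, D.y i ^ 2 = f.eval (D.x i))
    (hη : η ≠ 0) (hk : Odd k) (hs : Odd s) (hs3 : 3 ≤ s) (hsk : s ≤ k)
    (hn : Fintype.card ι + 3 ≤ 2 * k) (hkn : k + 4 ≤ Fintype.card ι) :
    2 * (Fintype.card ι - k) <
      finrank F (dualCode (D.twisted k s η) * dualCode (D.twisted k s η) :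
        Submodule F (ι → F)) := by
  classical
  obtain ⟨v, hvC, hv, hv0, hvk⟩ := D.exists_mem_dualCode_twisted hη (by omega) hsk (by omega)
  have hU := D.dualFil_le_dualCode_twisted η hsk
  generalize dualCode (D.twisted k s η) = C at hvC hU ⊢
  have hUU : D.dualFil (k + 2) * D.dualFil (k + 2) ≤ C * C := mul_le_mul' hU hU
  have hvU : ∀ u ∈ D.dualFil (k + 2), v * u ∈ C * C := fun u hu =>
    Submodule.mul_mem_mul hvC (hU hu)
  have hvv : v * v ∈ C * C := Submodule.mul_mem_mul hvC hvC
  have hlt : ∀ r, r < Fintype.card ι → ¬ D.IsLead r := fun r => D.not_isLead_of_lt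
  by_cases hL : D.IsLead (Fintype.card ι)
  · have hL1 : ¬ D.IsLead (Fintype.card ι + 1) := fun h =>
      lt_irrefl _ (D.card_lt_of_isLead_succ hL h)
    obtain ⟨R, hR⟩ : ∃ R : Finset ℕ, R = insert (2 * Fintype.card ι + 1)
      (Finset.Icc (2 * k + 3) (2 * Fintype.card ι - 1)) := ⟨_, rfl⟩
    have hRcard : R.card = 2 * Fintype.card ι - 2 * k - 2 := by
      rw [hR, Finset.card_insert_of_notMem (by simp), Nat.card_Icc]
      omega
    have hRlead : ∀ r ∈ R, D.IsLead r ∧ 2 * k + 3 ≤ r := by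
      intro r hr
      simp only [hR, Finset.mem_insert, Finset.mem_Icc] at hr
      exact ⟨D.isLead_of_card_add_two_le (by omega), by omega⟩
    have hRprod : ∀ P, D.dualFil (k + 2) * D.dualFil (k + 2) ≤ P → ∀ r ∈ R, D.IsProdVal P r := by
      intro P hP r hr
      have hprod : ∀ a b, ¬ D.IsLead a → ¬ D.IsLead b → k + 2 ≤ a → k + 2 ≤ b → a + b = r + 1 →
        D.IsProdVal P r := fun a b => D.isProdVal_of_dualFil hP
      simp only [hR, Finset.mem_insert, Finset.mem_Icc] at hr
      by_cases h1 : r = 2 * Fintype.card ι + 1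
      · exact hprod _ _ hL1 hL1 (by omega) (by omega) (by omega)
      by_cases h2 : r ≤ k + Fintype.card ι
      · exact hprod (k + 2) (r - k - 1) (hlt _ (by omega)) (hlt _ (by omega)) (by omega)
          (by omega) (by omega)
      by_cases h3 : r ≤ 2 * Fintype.card ι - 3
      · exact hprod (Fintype.card ι - 1) (r + 2 - Fintype.card ι) (hlt _ (by omega))
          (hlt _ (by omega)) (by omega) (by omega) (by omega)
      · exact hprod (Fintype.card ι + 1) (r - Fintype.card ι) hL1 (hlt _ (by omega)) (by omega)
          (by omega) (by omega)
    by_cases hex : s = 3 ∧ Fintype.card ι = k + 4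
    · obtain ⟨rfl, hk4⟩ := hex
      obtain ⟨c, rfl⟩ := hk
      have hxv := D.hasVal_x_mul_of_three (by omega) hv0 hvk
      have hlead : D.IsLead (4 * c - 1) := by
        by_cases hc : c = 3
        · subst hc; rwa [hk4] at hL
        · exact D.isLead_of_card_add_two_le (by omega)
      let Λ := dotProductBilin F F (D.pairVec (4 * c - 1)) ∘ₗ LinearMap.mulLeft F (D.x * D.x)
      have hΛ : ∀ u w, Λ (u * w) = D.pairVec (4 * c - 1) ⬝ᵥ (D.x * u * (D.x * w)) := by
        intro u w
        simp only [Λ, LinearMap.comp_apply, LinearMap.mulLeft_apply, dotProductBilin_apply_apply]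
        rw [mul_mul_mul_comm]
      have hvU' : ∀ u ∈ D.dualFil (2 * c + 1 + 2), v * u ∈ C * C ⊓ LinearMap.ker Λ := by
        intro u hu
        refine ⟨hvU u hu, ?_⟩
        rw [SetLike.mem_coe, LinearMap.mem_ker, hΛ]
        exact D.pairVec_dotProduct_eq_zero hlead hxv.1 (D.x_mul_mem_dualFil hu) (by omega)
      have hUU' : D.dualFil (2 * c + 1 + 2) * D.dualFil (2 * c + 1 + 2) ≤
          C * C ⊓ LinearMap.ker Λ := by
        refine le_inf hUU (Submodule.mul_le.2 fun u hu w hw => ?_)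
        rw [LinearMap.mem_ker, hΛ]
        exact D.pairVec_dotProduct_eq_zero hlead (D.x_mul_mem_dualFil hu)
          (D.x_mul_mem_dualFil hw) (by omega)
      have hlt' : C * C ⊓ LinearMap.ker Λ < C * C := by
        refine lt_of_le_of_ne inf_le_left fun h => ?_
        have : v * v ∈ C * C ⊓ LinearMap.ker Λ := h.ge hvv
        refine D.pairVec_dotProduct_ne_zero hlead hxv hxv (by omega) ?_
        rw [← hΛ]
        exact this.2
      have key := D.card_add_finrank_le
        (S := insert (Fintype.card ι) (insert (Fintype.card ι + 3) R)) (Q := ⊥)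
        (P := C * C ⊓ LinearMap.ker Λ) bot_le ?_ ?_ (by simp)
      · have := Submodule.finrank_lt_finrank_of_lt hlt'
        rw [Finset.card_insert_of_notMem, Finset.card_insert_of_notMem, hRcard] at key
        · omega
        · intro h; have := hRlead _ h; omega
        · intro h
          rw [Finset.mem_insert] at h
          obtain h | h := h
          · omega
          · have := hRlead _ h; omega
      · intro r hr
        simp only [Finset.mem_insert] at hr
        obtain rfl | rfl | hr := hr
        exacts [hL, D.isLead_of_card_add_two_le (by omega), (hRlead r hr).1]
      · intro r hr
        simp only [Finset.mem_insert] at hr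
        obtain rfl | rfl | hr := hr
        · exact D.isProdVal_of_hasVal hv hvU' (hlt (Fintype.card ι - 2) (by omega)) (by omega)
            (by omega)
        · exact D.isProdVal_of_hasVal hv hvU' hL1 (by omega) (by omega)
        · exact hRprod _ hUU' r hr
    · obtain ⟨r₁, r₂, r₃, h12, h23, h3, hr⟩ := D.exists_three_isProdVal hk hs hs3 hsk (by grind)
        hn hkn hv hv0 hvk hvU hvv (fun h => hex h.2)
      have hdisj : Disjoint {r₁, r₂, r₃} R := by
        refine Finset.disjoint_left.2 fun r h h' => ?_
        have := hRlead r h'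
        simp only [Finset.mem_insert, Finset.mem_singleton] at h
        omega
      have key := D.card_add_finrank_le (S := {r₁, r₂, r₃} ∪ R) (Q := ⊥) (P := C * C) bot_le
        (fun r h => (Finset.mem_union.1 h).elim (fun h => (hr r h).1) fun h => (hRlead r h).1)
        (fun r h => (Finset.mem_union.1 h).elim (fun h => (hr r h).2) fun h => hRprod _ hUU r h)
        (by simp)
      rw [Finset.card_union_of_disjoint hdisj, hRcard,
        Finset.card_eq_three.2 ⟨r₁, r₂, r₃, by omega, by omega, by omega, rfl⟩] at key
      omega
  · obtain ⟨r₁, r₂, r₃, h12, h23, h3, hr⟩ := D.exists_three_isProdVal hk hs hs3 hsk (by grind)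
      hn hkn hv hv0 hvk hvU hvv (fun h => hL h.1)
    obtain ⟨e, heU, he, hez⟩ := D.exists_mem_mul_pairVec_eq_zero h2 hf hf3 hfc hL hkn (by omega)
    have hle : ∀ r, r ≤ Fintype.card ι → ¬ D.IsLead r := fun r hr =>
      hr.lt_or_eq.elim (hlt r) fun h => h ▸ hL
    have hlead : ∀ r ∈ ({r₁, r₂, r₃} ∪ Finset.Icc (2 * k + 3) (2 * Fintype.card ι - 1) : Finset ℕ),
        D.IsLead r := fun r h => (Finset.mem_union.1 h).elim (fun h => (hr r h).1) fun h =>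
      D.isLead_of_card_lt hL (by rw [Finset.mem_Icc] at h; omega) (by
        rw [Finset.mem_Icc] at h; omega)
    have hdisj : Disjoint {r₁, r₂, r₃} (Finset.Icc (2 * k + 3) (2 * Fintype.card ι - 1)) := by
      refine Finset.disjoint_left.2 fun r h h' => ?_
      simp only [Finset.mem_insert, Finset.mem_singleton, Finset.mem_Icc] at h h'
      omega
    have key := D.card_add_finrank_le (P := C * C) (Q := Submodule.span F {e})
      ((Submodule.span_singleton_le_iff_mem _ _).2 (hUU heU)) hlead ?_ ?_
    · rw [Finset.card_union_of_disjoint hdisj, Nat.card_Icc, finrank_span_singleton he,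
        Finset.card_eq_three.2 ⟨r₁, r₂, r₃, by omega, by omega, by omega, rfl⟩] at key
      omega
    · intro r h
      obtain h | h := Finset.mem_union.1 h
      · exact (hr r h).2
      rw [Finset.mem_Icc] at h
      by_cases h1 : r + 1 ≤ k + 2 + Fintype.card ι
      · exact D.isProdVal_of_dualFil hUU (hle (k + 2) (by omega)) (hle (r - k - 1) (by omega))
          (by omega) (by omega) (by omega)
      · exact D.isProdVal_of_dualFil hUU (hle (Fintype.card ι) le_rfl)
          (hle (r + 1 - Fintype.card ι) (by omega)) (by omega) (by omega) (by omega)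
    · intro r h q hq
      obtain ⟨c, rfl⟩ := Submodule.mem_span_singleton.1 hq
      rw [dotProduct_smul, hez r (hlead r h), smul_zero]
      simp only [Finset.mem_union, Finset.mem_insert, Finset.mem_singleton, Finset.mem_Icc] at h
      omega

omit D [Fintype ι] in
/-- Points on `y² = f(x)` for a cubic polynomial `f`. -/
def ofPolynomial {f : F[X]} (hf : f.natDegree = 3) (x y : ι → F)
    (hxy : Function.Injective fun i => (x i, y i)) (hcurve : ∀ i, y i ^ 2 = f.eval (x i)) :
    CubicPoints ι F where
  x := x
  y := y
  c₀ := f.coeff 0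
  c₁ := f.coeff 1
  c₂ := f.coeff 2
  c₃ := f.coeff 3
  lead_ne := by
    rw [← hf]
    exact leadingCoeff_ne_zero.2 fun h => by simp [h] at hf
  curve i := by
    rw [hcurve, eval_eq_sum_range, hf]
    simp only [Finset.sum_range_succ, Finset.sum_range_zero]
    ring
  inj _ _ hx hy := hxy (Prod.ext hx hy)

omit [Fintype ι] in
theorem span_eq_below {k : ℕ} (hk : Odd k) (hk3 : 3 ≤ k) :
    Submodule.span F (Set.range (Sum.elim
      (fun (a : Fin (k / 2 + 1)) => fun i => D.x i ^ (a : ℕ))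
      (fun (b : Fin ((k - 3) / 2 + 1)) => fun i => D.x i ^ (b : ℕ) * D.y i))) =
    D.below (k + 1) := by
  obtain ⟨c, rfl⟩ := hk
  refine le_antisymm (Submodule.span_le.2 ?_) (Submodule.span_le.2 ?_)
  · rintro _ ⟨a | b, rfl⟩
    · have := D.mono_mem_below (N := 2 * c + 1 + 1) (show 2 * (a : ℕ) < _ by omega)
      rwa [mono_even] at this
    · have := D.mono_mem_below (N := 2 * c + 1 + 1) (show 2 * (b : ℕ) + 3 < _ by omega)
      rwa [mono_odd] at this
  · rintro _ ⟨j, hj, rfl⟩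
    have hj' : j < 2 * c + 1 + 1 := hj
    obtain rfl | ⟨a, rfl⟩ | ⟨a, rfl⟩ := eq_even_or_odd j
    · exact zero_mem _
    · exact Submodule.subset_span ⟨Sum.inl ⟨a, by omega⟩, (D.mono_even a).symm⟩
    · exact Submodule.subset_span ⟨Sum.inr ⟨a, by omega⟩, (D.mono_odd a).symm⟩

omit [Fintype ι] in
theorem span_eq_twisted {k ℓ : ℕ} (hk : Odd k) (hk3 : 3 ≤ k) (hℓ : ℓ ≤ (k - 3) / 2) (η : F) :
    Submodule.span F (Set.range (Sum.elim
      (fun (a : Fin ((k - 1) / 2 + 1)) => fun i => D.x i ^ (a : ℕ))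
      (fun (b : Fin ((k - 3) / 2 + 1)) => fun i => D.x i ^ (b : ℕ) * D.y i +
        if (b : ℕ) = ℓ then η * D.x i ^ ((k + 1) / 2) else 0))) =
    D.twisted k (2 * ℓ + 3) η := by
  obtain ⟨c, rfl⟩ := hk
  have hgen : (fun i => D.x i ^ ℓ * D.y i + if ℓ = ℓ then η * D.x i ^ ((2 * c + 1 + 1) / 2) else 0) =
      D.twistedGen (2 * c + 1) (2 * ℓ + 3) η (2 * c + 1 + 1) := by
    rw [twistedGen, if_pos rfl, mono_odd, show 2 * c + 1 + 1 = 2 * (c + 1) by ring, mono_even]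
    ext i
    simp
  refine le_antisymm (Submodule.span_le.2 ?_) (Submodule.span_le.2 ?_)
  · rintro _ ⟨a | b, rfl⟩
    · have := D.twistedGen_mem (k := 2 * c + 1) (s := 2 * ℓ + 3) (η := η) (j := 2 * a) (by omega)
        (by omega)
      rw [twistedGen, if_neg (by omega), mono_even] at this
      exact this
    · obtain ⟨b, hb⟩ := b
      by_cases hbl : b = ℓ
      · subst hbl
        have := D.twistedGen_mem (k := 2 * c + 1) (s := 2 * b + 3) (η := η)
          (j := 2 * c + 1 + 1) le_rfl (by omega)
        rwa [← hgen] at this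
      · have := D.twistedGen_mem (k := 2 * c + 1) (s := 2 * ℓ + 3) (η := η) (j := 2 * b + 3)
          (by omega) (by omega)
        rw [twistedGen, if_neg (by omega), mono_odd] at this
        have heq : (fun i => D.x i ^ b * D.y i +
            if b = ℓ then η * D.x i ^ ((2 * c + 1 + 1) / 2) else 0) = D.x ^ b * D.y := by
          ext i
          simp [hbl]
        rwa [← heq] at this
  · rintro _ ⟨j, ⟨hj, hjs⟩, rfl⟩
    by_cases hjk : j = 2 * c + 1 + 1
    · subst hjk
      exact Submodule.subset_span ⟨Sum.inr ⟨ℓ, by omega⟩, hgen⟩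
    rw [twistedGen, if_neg hjk]
    obtain rfl | ⟨a, rfl⟩ | ⟨b, rfl⟩ := eq_even_or_odd j
    · exact zero_mem _
    · exact Submodule.subset_span ⟨Sum.inl ⟨a, by omega⟩, (D.mono_even a).symm⟩
    · refine Submodule.subset_span ⟨Sum.inr ⟨b, by omega⟩, ?_⟩
      rw [mono_odd]
      ext i
      simp [show b ≠ ℓ by omega]

end CubicPoints

theorem stmt_18 (F : Type*) [Field F] [Fintype F] (hchar : ringChar F ≠ 2)
    (f : F[X]) (hsf : Squarefree f) (hdeg : f.natDegree = 3)
    (n : ℕ) (α β : Fin n → F)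
    (hdist : Function.Injective (fun i => (α i, β i)))
    (hβ0 : ∀ i, β i ≠ 0)
    (hcurve : ∀ i, β i ^ 2 = f.eval (α i))
    (k : ℕ) (hk : Odd k)
    (hkr : (4 ≤ k ∧ k ≤ (n - 4) / 2) ∨ ((n + 4) / 2 ≤ k ∧ k ≤ n - 4))
    (ℓ : ℕ) (hℓ : ℓ ≤ (k - 3) / 2) (η : F) (hη : η ≠ 0)
    (C : Submodule F (Fin n → F))
    (hC : C = Submodule.span F (Set.range (Sum.elim
      (fun (a : Fin ((k - 1) / 2 + 1)) => fun i => α i ^ (a : ℕ))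
      (fun (b : Fin ((k - 3) / 2 + 1)) => fun i => α i ^ (b : ℕ) * β i +
        if (b : ℕ) = ℓ then η * α i ^ ((k + 1) / 2) else 0)))) :
    ∀ (g : F[X]), Squarefree g → g.natDegree = 3 →
    ∀ (α' β' : Fin n → F), Function.Injective (fun i => (α' i, β' i)) →
      (∀ i, β' i ^ 2 = g.eval (α' i)) →
    ∀ (σ : Equiv.Perm (Fin n)) (w : Fin n → F), (∀ i, w i ≠ 0) →
      (Submodule.span F (Set.range (Sum.elim
          (fun (a : Fin (k / 2 + 1)) => fun i => α' i ^ (a : ℕ))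
          (fun (b : Fin ((k - 3) / 2 + 1)) => fun i => α' i ^ (b : ℕ) * β' i)))
        : Set (Fin n → F)) ≠
        (fun c : Fin n → F => fun i => w i * c (σ i)) '' (C : Set (Fin n → F)) := by
  intro g _ hg3 α' β' hdist' hcurve' σ w hw heq
  have hk3 : 3 ≤ k := by omega
  let D := CubicPoints.ofPolynomial hdeg α β hdist hcurve
  let D' := CubicPoints.ofPolynomial hg3 α' β' hdist' hcurve'
  have hC : C = D.twisted k (2 * ℓ + 3) η := hC.trans (D.span_eq_twisted hk hk3 hℓ η)
  have heq : ((D'.below (k + 1) : Submodule F (Fin n → F)) : Set (Fin n → F)) =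
      (fun c : Fin n → F => fun i => w i * c (σ i)) '' (D.twisted k (2 * ℓ + 3) η) := by
    rw [← hC, ← heq, ← D'.span_eq_below hk hk3]
    rfl
  have hodd : Odd (2 * ℓ + 3) := ⟨ℓ + 1, by ring⟩
  have hcard : Fintype.card (Fin n) = n := Fintype.card_fin n
  rcases hkr with hkr | hkr
  · have hk5 : 5 ≤ k := by
      obtain ⟨c, rfl⟩ := hk
      omega
    have h1 := CubicPoints.finrank_mul_le_of_monomial (P := D.twisted k (2 * ℓ + 3) η)
      (Q := D'.below (k + 1)) σ hw fun c hc => by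
        rw [← SetLike.mem_coe, heq]
        exact ⟨c, hc, rfl⟩
    have h2 := D'.finrank_below_mul_below_le k (by omega)
    have h3 := D.le_finrank_twisted_mul_twisted hη hk hk5 hodd (by omega) (by omega) (by omega)
    omega
  · have h1 := CubicPoints.finrank_dualCode_mul_le_of_monomial (C := D.twisted k (2 * ℓ + 3) η)
      (C' := D'.below (k + 1)) σ hw fun c' hc' => by
        rw [← SetLike.mem_coe, heq] at hc'
        obtain ⟨c, hc, rfl⟩ := hc'
        exact ⟨c, hc, rfl⟩
    have h2 := Submodule.finrank_mono
      (mul_le_mul' (D'.dualCode_below_le (k + 1)) (D'.dualCode_below_le (k + 1)))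
    have h3 := D'.finrank_dualFil_mul_dualFil_le (k := k) (by omega) (by omega)
    have h4 := D.lt_finrank_dualCode_twisted_mul (Ring.two_ne_zero hchar)
      (PerfectField.separable_iff_squarefree.2 hsf) hdeg hcurve hη hk hodd (by omega)
      (s := 2 * ℓ + 3) (by omega) (by omega) (by omega)
    omega
end
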